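/- Let d ≥ 2 and let V : ℝ^d → ℝ satisfy Assumptions 1–3 with min V = 0, and suppose the set S of local minima of V is not a singleton. Then there exist constants ε₀ > 0 and c > 0, depending only on V (and not on the temperature), such that for every ε ∈ (0, ε₀] the Gibbs measure μ_ε satisfies the Poincaré inequality PI(c); in other words, the Poincaré constant of μ_ε admits a temperature-independent positive lower bound as ε → 0. -/

import Mathlib

open MeasureTheory Real Filter Metric Set
open scoped RealInnerProductSpace ENNReal Topology

noncomputable section

abbrev Euc (n : ℕ) := EuclideanSpace ℝ (Fin n)

variable {d : ℕ}

def localMinSet (V : Euc d → ℝ) : Set (Euc d) := {x | IsLocalMin V x}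

def localMaxSet (V : Euc d → ℝ) : Set (Euc d) := {x | IsLocalMax V x}

def hessQ (V : Euc d → ℝ) (x v : Euc d) : ℝ := ⟪fderiv ℝ (gradient V) x v, v⟫

def lap (V : Euc d → ℝ) (x : Euc d) : ℝ :=
  ∑ i, hessQ V x (EuclideanSpace.basisFun (Fin d) ℝ i)

def PoincareIneq {d : ℕ} (μ : Measure (Euc d)) (ρ : ℝ) : Prop :=
  ∀ f : Euc d → ℝ, ContDiff ℝ 1 f →
    Integrable (fun x => (f x) ^ 2) μ →
    Integrable (fun x => ‖gradient f x‖ ^ 2) μ →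
    ∫ x, (f x - ∫ y, f y ∂μ) ^ 2 ∂μ ≤ (1 / ρ) * ∫ x, ‖gradient f x‖ ^ 2 ∂μ

def gibbs (V : Euc d → ℝ) (ε : ℝ) : Measure (Euc d) :=
  (ENNReal.ofReal (∫ x, exp (-V x / ε)))⁻¹ •
    volume.withDensity fun x => ENNReal.ofReal (exp (-V x / ε))

def gibbsOn (V : Euc d → ℝ) (ε : ℝ) (U : Set (Euc d)) : Measure (Euc d) :=
  (ENNReal.ofReal (∫ x in U, exp (-V x / ε)))⁻¹ •
    (volume.restrict U).withDensity fun x => ENNReal.ofReal (exp (-V x / ε))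

def uniformOn {d : ℕ} (U : Set (Euc d)) : Measure (Euc d) :=
  (volume U)⁻¹ • volume.restrict U

def Assumption1 (V : Euc d → ℝ) (ν : ℝ) (𝒩 : Set (Euc d) → Set (Euc d)) : Prop :=
  0 < ν ∧ ∀ x ∈ localMinSet V,
    IsOpen (𝒩 (connectedComponentIn (localMinSet V) x)) ∧
    connectedComponentIn (localMinSet V) x ⊆ 𝒩 (connectedComponentIn (localMinSet V) x) ∧
    ContDiffOn ℝ 3 V (𝒩 (connectedComponentIn (localMinSet V) x)) ∧
    ∀ y ∈ 𝒩 (connectedComponentIn (localMinSet V) x),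
      ν * (V y - sInf (V '' 𝒩 (connectedComponentIn (localMinSet V) x))) ≤ ‖gradient V y‖ ^ 2

def NSet (V : Euc d → ℝ) (𝒩 : Set (Euc d) → Set (Euc d)) : Set (Euc d) :=
  ⋃ x ∈ localMinSet V, 𝒩 (connectedComponentIn (localMinSet V) x)

def Assumption2 (V : Euc d → ℝ) (𝒩 : Set (Euc d) → Set (Euc d)) : Prop :=
  ∀ x ∉ NSet V 𝒩, gradient V x = 0 → ∀ v : Euc d, v ≠ 0 → hessQ V x v < 0

def Assumption3 (V : Euc d → ℝ) (R₀ ν_eb C_g : ℝ) : Prop :=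
  0 < R₀ ∧ 0 < ν_eb ∧ 0 < C_g ∧
  (∀ x : Euc d, R₀ ≤ ‖x‖ →
      ν_eb * infDist x (localMinSet V) ≤ ‖gradient V x‖ ∧ |lap V x| ≤ C_g * ‖x‖ ^ 2) ∧
  Tendsto V (cocompact (Euc d)) atTop ∧
  localMinSet V ⊆ closedBall 0 R₀

lemma grad_apply (V : Euc d → ℝ) (x v : Euc d) : fderiv ℝ V x v = ⟪gradient V x, v⟫ :=
  (inner_gradient_left).symm

lemma grad_contDiff {V : Euc d → ℝ} {n : WithTop ℕ∞} (hV : ContDiff ℝ (n+1) V) :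
    ContDiff ℝ n (gradient V) := by
  have h : ContDiff ℝ n (fderiv ℝ V) := hV.fderiv_right le_rfl
  exact (InnerProductSpace.toDual ℝ (Euc d)).symm.toContinuousLinearEquiv.contDiff.comp h

lemma grad_contDiff1 {V : Euc d → ℝ} (hV : ContDiff ℝ 2 V) : ContDiff ℝ 1 (gradient V) :=
  grad_contDiff (n := 1) (by simpa [one_add_one_eq_two] using hV)

lemma norm_grad (V : Euc d → ℝ) (x : Euc d) : ‖gradient V x‖ = ‖fderiv ℝ V x‖ := by
  simp [gradient]

lemma line_deriv {V : Euc d → ℝ} (hV : Differentiable ℝ V) (x v : Euc d) (t : ℝ) :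
    HasDerivAt (fun t : ℝ => V (x + t • v)) ⟪gradient V (x + t • v), v⟫ t := by
  have h1 : HasDerivAt (fun t : ℝ => x + t • v) v t := by
    simpa using ((hasDerivAt_id t).smul_const v).const_add x
  have := (hV (x + t • v)).hasFDerivAt.comp_hasDerivAt t h1
  rwa [grad_apply] at this

lemma hess_symm {V : Euc d → ℝ} (hV : ContDiff ℝ 2 V) (x v w : Euc d) :
    ⟪fderiv ℝ (gradient V) x v, w⟫ = ⟪fderiv ℝ (gradient V) x w, v⟫ := by
  have hs := (hV.contDiffAt (x := x)).isSymmSndFDerivAt (by simp)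
  have hd : DifferentiableAt ℝ (gradient V) x := (grad_contDiff1 hV).differentiable (by simp) x
  have key : ∀ a b : Euc d, fderiv ℝ (fderiv ℝ V) x a b = ⟪fderiv ℝ (gradient V) x a, b⟫ := by
    intro a b
    have hd2 : DifferentiableAt ℝ (fderiv ℝ V) x :=
      (hV.fderiv_right (m := 1) (by norm_num)).differentiable (by simp) x
    have h1 := hd2.hasFDerivAt.clm_apply (hasFDerivAt_const b x)
    have h2 : HasFDerivAt (fun y => fderiv ℝ V y b) ((innerSL ℝ b).comp (fderiv ℝ (gradient V) x)) x := by
      have := (innerSL ℝ b).hasFDerivAt.comp x hd.hasFDerivAt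
      refine this.congr_of_eventuallyEq (Eventually.of_forall fun y => ?_)
      change fderiv ℝ V y b = ⟪b, gradient V y⟫
      rw [grad_apply, real_inner_comm]
    have := congrArg (fun D : Euc d →L[ℝ] ℝ => D a) (h1.unique h2)
    simpa [real_inner_comm] using this
  rw [← key, ← key]; exact hs v w

/-- Descent lemma. If `h ≥ 0` has derivative `-⟨k t⟩` etc. -/
lemma descent_line {h h' : ℝ → ℝ} {η G T : ℝ} (hT : 0 < T)
    (hd : ∀ t ∈ Icc (0:ℝ) T, HasDerivAt h (h' t) t)
    (hb : ∀ t ∈ Icc (0:ℝ) T, h' t ≤ -G + η * G * t) :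
    h T ≤ h 0 - G * T + η * G * T ^ 2 / 2 := by
  have hd2 : ∀ t : ℝ, HasDerivAt (fun t => -G * t + η * G * t ^ 2 / 2) (-G + η * G * t) t := by
    intro t
    have h1 : HasDerivAt (fun t : ℝ => -G * t + (η * G / 2) * t ^ 2) (-G * 1 + (η * G / 2) * (2 * t)) t := by
      have := ((hasDerivAt_id' t).const_mul (-G)).fun_add ((hasDerivAt_pow 2 t).const_mul (η * G / 2))
      simpa using this
    have e1 : (fun t : ℝ => -G * t + η * G * t ^ 2 / 2) = (fun t : ℝ => -G * t + (η * G / 2) * t ^ 2) := by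
      funext s; ring
    rw [e1, show -G + η * G * t = -G * 1 + (η * G / 2) * (2 * t) by ring]
    exact h1
  have hanti : AntitoneOn (fun t => h t - (-G * t + η * G * t ^ 2 / 2)) (Icc 0 T) := by
    apply antitoneOn_of_hasDerivWithinAt_nonpos (convex_Icc 0 T) (f' := fun t => h' t - (-G + η * G * t))
    · intro t ht
      exact ((hd t ht).sub (hd2 t)).continuousAt.continuousWithinAt
    · intro t ht
      rw [interior_Icc] at ht
      exact ((hd t (Ioo_subset_Icc_self ht)).sub (hd2 t)).hasDerivWithinAt
    · intro t ht
      rw [interior_Icc] at ht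
      linarith [hb t (Ioo_subset_Icc_self ht)]
  have := hanti (left_mem_Icc.2 hT.le) (right_mem_Icc.2 hT.le) hT.le
  simp only [mul_zero] at this
  nlinarith

/-- a nonneg function along a line of steepest descent -/
lemma descent_nonneg {h h' : ℝ → ℝ} {η G : ℝ} (hη : 0 < η)
    (hd : ∀ t ∈ Icc (0:ℝ) (1/η), HasDerivAt h (h' t) t)
    (hb : ∀ t ∈ Icc (0:ℝ) (1/η), h' t ≤ -G + η * G * t) (h0 : 0 ≤ h (1/η)) :
    G ≤ 2 * η * h 0 := by
  have := descent_line (by positivity : 0 < 1/η) hd hb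
  have e : h 0 - G * (1/η) + η * G * (1/η) ^ 2 / 2 = h 0 - G / (2*η) := by field_simp; ring
  rw [e] at this
  have : G / (2*η) ≤ h 0 := by linarith
  rw [div_le_iff₀ (by positivity)] at this
  linarith

/-- `|∇V|² ≤ 2 L V` locally. -/
lemma grad_sq_le {V : Euc d → ℝ} (hV : ContDiff ℝ 2 V) (h0 : ∀ x, 0 ≤ V x) (x₀ : Euc d)
    (hx0 : gradient V x₀ = 0) :
    ∃ L > 0, ∀ᶠ x in 𝓝 x₀, ‖gradient V x‖ ^ 2 ≤ L * V x := by
  have hdV : Differentiable ℝ V := hV.differentiable (by simp)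
  obtain ⟨K, t, ht, hK⟩ := ((grad_contDiff1 hV).contDiffAt (x := x₀)).exists_lipschitzOnWith
  obtain ⟨r, hr, hball⟩ := Metric.mem_nhds_iff.1 ht
  set L : ℝ := K + 1
  have hL : 0 < L := by positivity
  have hlip : ∀ a ∈ ball x₀ r, ∀ b ∈ ball x₀ r, ‖gradient V a - gradient V b‖ ≤ L * ‖a - b‖ := by
    intro a ha b hb
    have := hK.dist_le_mul a (hball ha) b (hball hb)
    rw [dist_eq_norm, dist_eq_norm] at this
    refine this.trans (mul_le_mul_of_nonneg_right (by simp [L]) (norm_nonneg _))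
  refine ⟨2 * L, by positivity, ?_⟩
  filter_upwards [ball_mem_nhds x₀ (by positivity : 0 < r/2)] with x hx
  have hxr : x ∈ ball x₀ r := ball_subset_ball (by linarith) hx
  rw [mem_ball, dist_eq_norm] at hx
  set u := gradient V x
  have hu : ‖u‖ ≤ L * ‖x - x₀‖ := by
    have := hlip x hxr x₀ (mem_ball_self hr)
    rwa [hx0, sub_zero] at this
  have hmem : ∀ t ∈ Icc (0:ℝ) (1/L), x + t • (-u) ∈ ball x₀ r := by
    intro t ht
    rw [mem_ball, dist_eq_norm]
    have h1 : ‖t • u‖ ≤ ‖x - x₀‖ := by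
      rw [norm_smul, Real.norm_of_nonneg ht.1]
      calc t * ‖u‖ ≤ (1/L) * (L * ‖x - x₀‖) := by gcongr; exact ht.2
        _ = _ := by field_simp
    calc ‖x + t • (-u) - x₀‖ = ‖(x - x₀) - t • u‖ := by congr 1; simp; abel
      _ ≤ ‖x - x₀‖ + ‖t • u‖ := norm_sub_le _ _
      _ < r := by linarith
  have := descent_nonneg (h := fun t : ℝ => V (x + t • (-u))) (G := ‖u‖^2) hL
    (fun t _ => line_deriv hdV x (-u) t) (fun t ht => ?_) (h0 _)
  · simpa using this
  · have h1 := hlip _ (hmem t ht) x hxr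
    have e : ⟪gradient V (x + t • (-u)), -u⟫ = - ‖u‖^2 - ⟪gradient V (x + t • (-u)) - u, u⟫ := by
      rw [inner_sub_left, inner_neg_right, real_inner_self_eq_norm_sq]; ring
    rw [e]
    have h2 := abs_real_inner_le_norm (gradient V (x + t • (-u)) - u) u
    have h3 : ‖x + t • (-u) - x‖ = t * ‖u‖ := by
      rw [add_sub_cancel_left, norm_smul, norm_neg, Real.norm_of_nonneg ht.1]
    rw [h3] at h1
    have h4 := mul_le_mul_of_nonneg_right h1 (norm_nonneg u)
    have := neg_abs_le (⟪gradient V (x + t • (-u)) - u, u⟫)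
    nlinarith

lemma nd_bound {V : Euc d → ℝ} {x : Euc d} (h : ∀ v : Euc d, v ≠ 0 → hessQ V x v < 0) :
    ∃ l > 0, ∀ v, hessQ V x v ≤ -l * ‖v‖ ^ 2 := by
  have hc : Continuous (fun v => - hessQ V x v) := by
    unfold hessQ; fun_prop
  obtain ⟨l, hl, hl2⟩ := (isCompact_sphere (0 : Euc d) 1).exists_forall_le' (a := 0) hc.continuousOn
    (fun v hv => by
      have : v ≠ 0 := by rintro rfl; simp at hv
      linarith [h v this])
  refine ⟨l, hl, fun v => ?_⟩
  by_cases hv : v = 0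
  · simp [hv, hessQ]
  have hn : 0 < ‖v‖ := norm_pos_iff.2 hv
  have h1 := hl2 (‖v‖⁻¹ • v) (by simp [norm_smul, hn.ne'])
  have e : hessQ V x v = ‖v‖^2 * hessQ V x (‖v‖⁻¹ • v) := by
    simp only [hessQ, map_smul, inner_smul_left, inner_smul_right]
    simp; field_simp
  rw [e]; nlinarith [sq_nonneg ‖v‖]

lemma nd_near {V : Euc d → ℝ} (hV : ContDiff ℝ 2 V) {x : Euc d} (hx : gradient V x = 0)
    (h : ∀ v : Euc d, v ≠ 0 → hessQ V x v < 0) :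
    ∃ δ > 0, ∀ u ∈ ball x δ, u ≠ x → ⟪gradient V u, u - x⟫ < 0 := by
  obtain ⟨l, hl, hl2⟩ := nd_bound h
  have hd : HasFDerivAt (gradient V) (fderiv ℝ (gradient V) x) x :=
    ((grad_contDiff1 hV).differentiable (by simp) x).hasFDerivAt
  have h1 := hd.isLittleO.bound (half_pos hl)
  obtain ⟨δ, hδ, h2⟩ := Metric.eventually_nhds_iff_ball.1 h1
  refine ⟨δ, hδ, fun u hu hne => ?_⟩
  have h3 := h2 u hu
  rw [hx, sub_zero] at h3
  have hn : 0 < ‖u - x‖ := norm_pos_iff.2 (sub_ne_zero.2 hne)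
  have e : ⟪gradient V u, u - x⟫ = hessQ V x (u - x) +
      ⟪gradient V u - fderiv ℝ (gradient V) x (u - x), u - x⟫ := by
    rw [hessQ, inner_sub_left]; ring
  have h4 := (real_inner_le_norm (gradient V u - fderiv ℝ (gradient V) x (u - x)) (u - x))
  have h5 := mul_le_mul_of_nonneg_right h3 hn.le
  rw [e]
  nlinarith [hl2 (u - x), mul_pos hl (pow_pos hn 2)]

lemma nd_strictmax {V : Euc d → ℝ} (hV : ContDiff ℝ 2 V) {x : Euc d} (hx : gradient V x = 0)
    (h : ∀ v : Euc d, v ≠ 0 → hessQ V x v < 0) :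
    ∃ δ > 0, ∀ u ∈ ball x δ, u ≠ x → V u < V x ∧ gradient V u ≠ 0 := by
  have hdV : Differentiable ℝ V := hV.differentiable (by simp)
  obtain ⟨δ, hδ, h1⟩ := nd_near hV hx h
  refine ⟨δ, hδ, fun u hu hne => ⟨?_, fun h0 => ?_⟩⟩
  · have hanti : StrictAntiOn (fun t : ℝ => V (x + t • (u - x))) (Icc 0 1) := by
      apply strictAntiOn_of_deriv_neg (convex_Icc 0 1)
      · exact fun t _ => (line_deriv hdV x (u - x) t).continuousAt.continuousWithinAt
      · intro t ht
        rw [interior_Icc] at ht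
        rw [(line_deriv hdV x (u - x) t).deriv]
        have hm := h1 (x + t • (u - x)) (by
          rw [mem_ball, dist_eq_norm] at hu ⊢
          rw [add_sub_cancel_left, norm_smul, Real.norm_of_nonneg ht.1.le]
          nlinarith [norm_nonneg (u - x), ht.2])
          (by
            intro hh
            have : t • (u - x) = 0 := by simpa using hh
            rcases smul_eq_zero.1 this with h | h
            · exact ht.1.ne' h
            · exact hne (sub_eq_zero.1 h))
        rw [add_sub_cancel_left, inner_smul_right] at hm
        by_contra hc
        push Not at hc
        nlinarith [mul_nonneg ht.1.le hc]
    have := hanti (left_mem_Icc.2 zero_le_one) (right_mem_Icc.2 zero_le_one) zero_lt_one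
    simpa using this
  · have := h1 u hu hne
    simp [h0] at this

lemma punctured_joined (hd : 2 ≤ d) {x : Euc d} {δ : ℝ} {a b : Euc d}
    (ha : a ∈ ball x δ) (hb : b ∈ ball x δ) (hax : a ≠ x) (hbx : b ≠ x) :
    JoinedIn (ball x δ \ {x}) a b := by
  have hδ : 0 < δ := pos_of_mem_ball ha
  have hr : 1 < Module.rank ℝ (Euc d) := by
    rw [← Module.finrank_eq_rank]
    simp
    exact_mod_cast hd
  set Φ := OpenPartialHomeomorph.univBall x δ
  have hcont : Continuous Φ := OpenPartialHomeomorph.continuous_univBall x δ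
  have hT : Φ.target = ball x δ := OpenPartialHomeomorph.univBall_target x hδ
  have hS : Φ.source = univ := OpenPartialHomeomorph.univBall_source x δ
  have h0 : Φ 0 = x := OpenPartialHomeomorph.univBall_apply_zero x δ
  have himg : Φ '' {0}ᶜ = ball x δ \ {x} := by
    ext z
    constructor
    · rintro ⟨w, hw, rfl⟩
      refine ⟨hT ▸ Φ.map_source (by simp [hS]), fun h => hw ?_⟩
      exact Φ.injOn (by simp [hS]) (by simp [hS]) (h.trans h0.symm)
    · rintro ⟨hz, hzx⟩
      rw [← hT] at hz
      refine ⟨Φ.symm z, fun h => hzx ?_, Φ.right_inv hz⟩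
      have := Φ.right_inv hz
      rw [h, h0] at this
      exact this.symm
  rw [← himg]
  have := ((isPathConnected_compl_singleton_of_one_lt_rank hr (0 : Euc d)).image hcont).joinedIn
  exact this a (himg ▸ ⟨ha, hax⟩) b (himg ▸ ⟨hb, hbx⟩)

/-- local structure of sublevel sets at non-minimum points -/
lemma local_joined (hd : 2 ≤ d) {V : Euc d → ℝ} (hV : ContDiff ℝ 2 V) {y : Euc d} {c : ℝ}
    (hy : V y ≤ c)
    (hcr : V y = c → gradient V y = 0 → ∀ v : Euc d, v ≠ 0 → hessQ V y v < 0) :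
    ∃ W : Set (Euc d), IsOpen W ∧ y ∈ W ∧
      ∀ w ∈ W, ∀ w' ∈ W, V w < c → V w' < c → JoinedIn {z | V z < c} w w' := by
  have hdV : Differentiable ℝ V := hV.differentiable (by simp)
  rcases hy.lt_or_eq with hlt | heq
  · have ho : IsOpen {z | V z < c} := isOpen_lt hdV.continuous continuous_const
    obtain ⟨r, hr, hb⟩ := Metric.isOpen_iff.1 ho y hlt
    refine ⟨ball y r, isOpen_ball, mem_ball_self hr, fun w hw w' hw' _ _ => ?_⟩
    exact JoinedIn.of_segment_subset (((convex_ball y r).segment_subset hw hw').trans hb)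
  by_cases hg : gradient V y = 0
  · obtain ⟨δ, hδ, h1⟩ := nd_strictmax hV hg (hcr heq hg)
    refine ⟨ball y δ, isOpen_ball, mem_ball_self hδ, fun w hw w' hw' h h' => ?_⟩
    refine (punctured_joined hd hw hw' ?_ ?_).mono ?_
    · rintro rfl; linarith
    · rintro rfl; linarith
    · rintro z ⟨hz, hz2⟩
      have := (h1 z hz hz2).1
      simpa [← heq] using this
  · -- regular point
    set e := gradient V y
    have hn : 0 < ‖e‖ := norm_pos_iff.2 hg
    have hc : ContinuousAt (fun p : Euc d × Euc d => ⟪gradient V p.1, p.2⟫) (y, -e) := by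
      have := (grad_contDiff1 hV).continuous
      fun_prop
    have hneg : ⟪gradient V y, -e⟫ < 0 := by
      rw [inner_neg_right, real_inner_self_eq_norm_sq]
      have := pow_pos hn 2
      linarith
    have hev : ∀ᶠ p in 𝓝 (y, -e), ⟪gradient V p.1, p.2⟫ < 0 := hc.eventually (gt_mem_nhds hneg)
    obtain ⟨r, hr, hr2⟩ := Metric.eventually_nhds_iff_ball.1 hev
    have hneg' : ∀ z ∈ ball y r, ∀ v ∈ ball (-e) r, ⟪gradient V z, v⟫ < 0 := by
      intro z hz v hv
      exact hr2 (z, v) (by rw [← ball_prod_same]; exact ⟨hz, hv⟩)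
    -- p = y + s(-e)
    obtain ⟨s, hs, hs2⟩ : ∃ s : ℝ, 0 < s ∧ s * ‖e‖ < r := ⟨r / (2 * ‖e‖), by positivity, by field_simp; norm_num⟩
    set p := y + s • (-e)
    have hpy : p ∈ ball y r := by
      rw [mem_ball, dist_eq_norm, add_sub_cancel_left, norm_smul, norm_neg, Real.norm_of_nonneg hs.le]
      exact hs2
    have hseg : ∀ w ∈ ball y (min r (s * r)), V w < c → JoinedIn {z | V z < c} w p := by
      intro w hw hwc
      have hw1 : w ∈ ball y r := ball_subset_ball (min_le_left _ _) hw
      have hw2 : w ∈ ball y (s*r) := ball_subset_ball (min_le_right _ _) hw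
      apply JoinedIn.of_segment_subset
      have hanti : AntitoneOn (fun t : ℝ => V (w + t • (p - w))) (Icc 0 1) := by
        apply antitoneOn_of_deriv_nonpos (convex_Icc 0 1)
        · exact fun t _ => (line_deriv hdV w (p - w) t).continuousAt.continuousWithinAt
        · exact fun t _ => (line_deriv hdV w (p - w) t).differentiableAt.differentiableWithinAt
        · intro t ht
          rw [interior_Icc] at ht
          rw [(line_deriv hdV w (p - w) t).deriv]
          have hz : w + t • (p - w) ∈ ball y r :=
            (convex_ball y r).add_smul_sub_mem hw1 hpy ⟨ht.1.le, ht.2.le⟩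
          have hv : s⁻¹ • (p - w) ∈ ball (-e) r := by
            rw [mem_ball, dist_eq_norm] at hw2 ⊢
            have : s⁻¹ • (p - w) - -e = s⁻¹ • (y - w) := by
              have : s⁻¹ • s • (-e) = -e := by rw [smul_smul, inv_mul_cancel₀ hs.ne', one_smul]
              simp only [p]
              rw [show y + s • -e - w = (y - w) + s • (-e) by abel, smul_add, this]; abel
            rw [this, norm_smul, norm_inv, Real.norm_of_nonneg hs.le, norm_sub_rev, inv_mul_lt_iff₀ hs]
            exact hw2
          have := hneg' _ hz _ hv
          rw [inner_smul_right] at this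
          by_contra hcc
          push Not at hcc
          nlinarith [mul_pos (inv_pos.2 hs) hcc]
      rw [segment_eq_image']
      rintro z ⟨t, ht, rfl⟩
      have := hanti (left_mem_Icc.2 zero_le_one) ht ht.1
      simp only [zero_smul, add_zero] at this
      exact lt_of_le_of_lt this hwc
    exact ⟨_, isOpen_ball, mem_ball_self (by positivity), fun w hw w' hw' h h' =>
      (hseg w hw h).trans (hseg w' hw' h').symm⟩

lemma crit_class {V : Euc d → ℝ} {ν : ℝ} {𝒩 : Set (Euc d) → Set (Euc d)}
    (h1 : Assumption1 V ν 𝒩) (h2 : Assumption2 V 𝒩) (hmin0 : ∀ x, 0 ≤ V x) {x : Euc d}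
    (hx : gradient V x = 0) :
    x ∈ localMinSet V ∨ (∀ v : Euc d, v ≠ 0 → hessQ V x v < 0) := by
  by_cases hN : x ∈ NSet V 𝒩
  · left
    simp only [NSet, mem_iUnion] at hN
    obtain ⟨z, hz, hxz⟩ := hN
    obtain ⟨ho, -, -, hPL⟩ := h1.2 z hz
    have h := hPL x hxz
    rw [hx, norm_zero] at h
    have h' : V x ≤ sInf (V '' 𝒩 (connectedComponentIn (localMinSet V) z)) := by
      by_contra hc
      push Not at hc
      nlinarith [mul_pos h1.1 (sub_pos.2 hc)]
    filter_upwards [ho.mem_nhds hxz] with y hy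
    exact h'.trans (csInf_le ⟨0, by rintro _ ⟨w, -, rfl⟩; exact hmin0 w⟩ ⟨y, hy, rfl⟩)
  · exact Or.inr (h2 x hN hx)

lemma min_crit {V : Euc d → ℝ} {x : Euc d} (hx : x ∈ localMinSet V) : gradient V x = 0 := by
  have h : fderiv ℝ V x = 0 := IsLocalMin.fderiv_eq_zero hx
  simp [gradient, h]

lemma min_closed {V : Euc d → ℝ} (hV : ContDiff ℝ 2 V)
    (hcl : ∀ x, gradient V x = 0 → x ∈ localMinSet V ∨ (∀ v : Euc d, v ≠ 0 → hessQ V x v < 0)) :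
    IsClosed (localMinSet V) := by
  rw [← isOpen_compl_iff, Metric.isOpen_iff]
  intro x hx
  by_cases hg : gradient V x = 0
  · have hnd := (hcl x hg).resolve_left hx
    obtain ⟨δ, hδ, h⟩ := nd_strictmax hV hg hnd
    refine ⟨δ, hδ, fun u hu => ?_⟩
    by_cases hux : u = x
    · rwa [hux]
    · exact fun hm => (h u hu hux).2 (min_crit hm)
  · have ho : IsOpen {z | gradient V z ≠ 0} :=
      isOpen_ne_fun (grad_contDiff1 hV).continuous continuous_const
    obtain ⟨r, hr, hb⟩ := Metric.isOpen_iff.1 ho x hg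
    exact ⟨r, hr, fun u hu hm => hb hu (min_crit hm)⟩

lemma sublevel_compact {V : Euc d → ℝ} (hc : Continuous V)
    (hco : Tendsto V (cocompact (Euc d)) atTop) (c : ℝ) : IsCompact {x | V x ≤ c} := by
  have h := hco.eventually (eventually_gt_atTop c)
  rw [Filter.Eventually, mem_cocompact] at h
  obtain ⟨t, ht, h⟩ := h
  refine ht.of_isClosed_subset (isClosed_le hc continuous_const) fun x hx => ?_
  by_contra hxt
  have := h hxt
  simp only [mem_ofPred_eq] at this hx
  linarith

lemma sublevel_sub {V : Euc d → ℝ} (hc : Continuous V)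
    (hco : Tendsto V (cocompact (Euc d)) atTop) {c : ℝ} {O : Set (Euc d)} (hO : IsOpen O)
    (h : {x | V x ≤ c} ⊆ O) : ∃ c' > c, {x | V x ≤ c'} ⊆ O := by
  have hK : IsCompact ({x | V x ≤ c + 1} \ O) := (sublevel_compact hc hco (c+1)).diff hO
  obtain ⟨a, ha, ha2⟩ := hK.exists_forall_le' (a := c) hc.continuousOn (fun x hx => by
    by_contra hh
    push Not at hh
    exact hx.2 (h hh))
  obtain ⟨c', hc1, hc2⟩ := exists_between (lt_min ha (lt_add_one c))
  refine ⟨c', hc1, fun x hx => ?_⟩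
  by_contra hxO
  have h1 := ha2 x ⟨(le_of_lt (lt_of_le_of_lt hx (lt_of_lt_of_le hc2 (min_le_right _ _)))), hxO⟩
  have h2 := lt_of_lt_of_le hc2 (min_le_left _ _)
  simp only [mem_ofPred_eq] at hx
  linarith

lemma min_preconnected (hd : 2 ≤ d) {V : Euc d → ℝ} (hV : ContDiff ℝ 2 V)
    (hcl : ∀ x, gradient V x = 0 → x ∈ localMinSet V ∨ (∀ v : Euc d, v ≠ 0 → hessQ V x v < 0))
    (hco : Tendsto V (cocompact (Euc d)) atTop) :
    IsPreconnected (localMinSet V) := by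
  have hc : Continuous V := hV.continuous
  have hSc := min_closed hV hcl
  rw [isPreconnected_closed_iff]
  rintro t t' ht ht' hcov ⟨a, haS, hat⟩ ⟨b, hbS, hbt⟩
  by_contra hemp
  rw [Set.not_nonempty_iff_eq_empty] at hemp
  have hdis : ∀ x ∈ localMinSet V, x ∈ t → x ∈ t' → False := by
    intro x h1 h2 h3
    have : x ∈ localMinSet V ∩ (t ∩ t') := ⟨h1, h2, h3⟩
    rw [hemp] at this; exact this
  set J : Set ℝ := {c | JoinedIn {z | V z < c} a b}
  have hpath : ∀ {s : Set (Euc d)}, JoinedIn s a b → ∃ M, ∃ x ∈ s, V x = M ∧ ∀ c > M, c ∈ J := by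
    intro s hj
    obtain ⟨γ, hγ⟩ := hj
    obtain ⟨τ, -, hτ⟩ := isCompact_univ.exists_isMaxOn (univ_nonempty : (univ : Set unitInterval).Nonempty)
      (hc.comp γ.continuous).continuousOn
    refine ⟨V (γ τ), γ τ, hγ τ, rfl, fun c hcM => ⟨γ, fun s => ?_⟩⟩
    have : V (γ s) ≤ V (γ τ) := hτ (mem_univ s)
    exact lt_of_le_of_lt this hcM
  have hJne : J.Nonempty := by
    have : JoinedIn (univ : Set (Euc d)) a b := JoinedIn.of_segment_subset (subset_univ _)
    obtain ⟨M, -, -, -, h⟩ := hpath this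
    exact ⟨M + 1, h _ (by linarith)⟩
  have hJbd : BddBelow J := ⟨V a, fun c hcJ => (show V a < c from hcJ.source_mem).le⟩
  set c := sInf J
  have hJup : ∀ c' > c, c' ∈ J := by
    intro c' hc'
    obtain ⟨e, he, hec⟩ := exists_lt_of_csInf_lt hJne hc'
    exact JoinedIn.mono he (fun z hz => lt_trans hz hec)
  have hnot : ¬ JoinedIn {z | V z < c} a b := by
    intro hj
    obtain ⟨M, x, hx, hxM, h⟩ := hpath hj
    have hMc : M < c := hxM ▸ hx
    obtain ⟨e, he1, he2⟩ := exists_between hMc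
    exact absurd (csInf_le hJbd (h e he1)) (not_le.2 he2)
  have hac : V a ≤ c := le_csInf hJne fun e he => (show V a < e from he.source_mem).le
  have hbc : V b ≤ c := le_csInf hJne fun e he => (show V b < e from he.target_mem).le
  set Y : Set (Euc d) := {x | V x ≤ c}
  have hYc : IsCompact Y := sublevel_compact hc hco c
  set Z : Set (Euc d) := localMinSet V ∩ {x | V x = c}
  have hZcl : IsClosed Z := hSc.inter (isClosed_eq hc continuous_const)
  have hYZ : IsClosed (Y \ Z) := by
    rw [← isOpen_compl_iff, isOpen_iff_mem_nhds]
    intro x hx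
    by_cases hxY : x ∈ Y
    · have hxZ : x ∈ Z := by by_contra h; exact hx ⟨hxY, h⟩
      have h1 : ∀ᶠ y in 𝓝 x, ∀ᶠ z in 𝓝 y, V x ≤ V z := eventually_eventually_nhds.2 hxZ.1
      filter_upwards [h1] with y hy hy2
      have e : V y = c := le_antisymm hy2.1 (hxZ.2 ▸ hy.self_of_nhds)
      refine hy2.2 ⟨?_, e⟩
      have hxc : V x = c := hxZ.2
      filter_upwards [hy] with z hz
      rw [e, ← hxc]; exact hz
    · filter_upwards [hYc.isClosed.isOpen_compl.mem_nhds hxY] with y hy hy2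
      exact hy hy2.1
  set U1 : Set (Euc d) := ⋃₀ {W | IsOpen W ∧ ∀ w ∈ W, V w < c → JoinedIn {z | V z < c} a w}
  set U2 : Set (Euc d) := ⋃₀ {W | IsOpen W ∧ ∀ w ∈ W, V w < c → ¬ JoinedIn {z | V z < c} a w}
  have hU1 : IsOpen U1 := isOpen_sUnion fun W hW => hW.1
  have hU2 : IsOpen U2 := isOpen_sUnion fun W hW => hW.1
  have hUcov : ∀ y ∈ Y \ Z, y ∈ U1 ∨ y ∈ U2 := by
    intro y hy
    obtain ⟨W, hWo, hyW, hW⟩ := local_joined hd hV (y := y) (c := c) hy.1 (fun he hg =>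
      (hcl y hg).resolve_left (fun hm => hy.2 ⟨hm, he⟩))
    by_cases hex : ∃ w ∈ W, V w < c ∧ JoinedIn {z | V z < c} a w
    · obtain ⟨w, hw, hwc, hwj⟩ := hex
      exact Or.inl ⟨W, ⟨hWo, fun w' hw' hwc' => hwj.trans (hW w hw w' hw' hwc hwc')⟩, hyW⟩
    · push Not at hex
      exact Or.inr ⟨W, ⟨hWo, fun w' hw' hwc' => hex w' hw' hwc'⟩, hyW⟩
  have hUdis : ∀ y ∈ Y \ Z, y ∈ U1 → y ∈ U2 → False := by
    rintro y hy ⟨W1, ⟨ho1, h1⟩, hy1⟩ ⟨W2, ⟨ho2, h2⟩, hy2⟩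
    have hex : ∃ w ∈ W1 ∩ W2, V w < c := by
      rcases (show V y ≤ c from hy.1).lt_or_eq with hlt | heq
      · exact ⟨y, ⟨hy1, hy2⟩, hlt⟩
      · have hnm : ¬ IsLocalMin V y := fun hm => hy.2 ⟨hm, heq⟩
        by_contra hcon
        push Not at hcon
        apply hnm
        filter_upwards [(ho1.inter ho2).mem_nhds ⟨hy1, hy2⟩] with w hw
        rw [heq]; exact hcon w hw
    obtain ⟨w, hw, hwc⟩ := hex
    exact h2 w hw.2 hwc (h1 w hw.1 hwc)
  set C1 : Set (Euc d) := ((Y \ Z) \ U2) ∪ (Z ∩ t)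
  set C2 : Set (Euc d) := ((Y \ Z) \ U1) ∪ (Z ∩ t')
  have hZY : Z ⊆ Y := fun x hx => le_of_eq hx.2
  have hYZc : IsCompact (Y \ Z) := hYc.of_isClosed_subset hYZ sdiff_subset
  have hZc : IsCompact Z := hYc.of_isClosed_subset hZcl hZY
  have hC1 : IsCompact C1 := (hYZc.diff hU2).union (hZc.inter_right ht)
  have hC2 : IsCompact C2 := (hYZc.diff hU1).union (hZc.inter_right ht')
  have hCd : Disjoint C1 C2 := by
    rw [Set.disjoint_left]
    rintro x (⟨h1, h2⟩ | ⟨h1, h2⟩) (⟨h3, h4⟩ | ⟨h3, h4⟩)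
    · exact (hUcov x h1).elim h4 h2
    · exact h1.2 h3
    · exact h3.2 h1
    · exact hdis x h1.1 h2 h4
  have hYC : Y ⊆ C1 ∪ C2 := by
    intro x hx
    by_cases hxZ : x ∈ Z
    · rcases hcov hxZ.1 with h | h
      · exact Or.inl (Or.inr ⟨hxZ, h⟩)
      · exact Or.inr (Or.inr ⟨hxZ, h⟩)
    · by_cases hx1 : x ∈ U1
      · exact Or.inl (Or.inl ⟨⟨hx, hxZ⟩, fun hx2 => hUdis x ⟨hx, hxZ⟩ hx1 hx2⟩)
      · exact Or.inr (Or.inl ⟨⟨hx, hxZ⟩, hx1⟩)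
  have haC : a ∈ C1 := by
    by_cases haZ : a ∈ Z
    · exact Or.inr ⟨haZ, hat⟩
    · refine Or.inl ⟨⟨hac, haZ⟩, ?_⟩
      rintro ⟨W, ⟨-, hW⟩, haW⟩
      have hlt : V a < c := lt_of_le_of_ne hac (fun h => haZ ⟨haS, h⟩)
      exact hW a haW hlt (JoinedIn.refl hlt)
  have hbC : b ∈ C2 := by
    by_cases hbZ : b ∈ Z
    · exact Or.inr ⟨hbZ, hbt⟩
    · refine Or.inl ⟨⟨hbc, hbZ⟩, ?_⟩
      rintro ⟨W, ⟨-, hW⟩, hbW⟩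
      have hlt : V b < c := lt_of_le_of_ne hbc (fun h => hbZ ⟨hbS, h⟩)
      exact hnot (hW b hbW hlt)
  obtain ⟨O1, O2, hO1, hO2, hs1, hs2, hO⟩ := SeparatedNhds.of_isCompact_isCompact hC1 hC2 hCd
  obtain ⟨c', hc', hsub⟩ := sublevel_sub hc hco (hO1.union hO2)
    (hYC.trans (union_subset_union hs1 hs2))
  obtain ⟨γ, hγ⟩ := hJup c' hc'
  have hpre : IsPreconnected (range γ) := isPreconnected_range γ.continuous
  have := hpre O1 O2 hO1 hO2 (by
    rintro _ ⟨s, rfl⟩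
    have h3 : V (γ s) < c' := hγ s
    exact hsub (show V (γ s) ≤ c' from h3.le)) ⟨a, ⟨0, γ.source⟩, hs1 haC⟩ ⟨b, ⟨1, γ.target⟩, hs2 hbC⟩
  obtain ⟨x, -, hx1, hx2⟩ := this
  exact Set.disjoint_left.1 hO hx1 hx2

/-- Summary of the topological part. -/
lemma topo_summary (hd : 2 ≤ d) (V : Euc d → ℝ) (hV : ContDiff ℝ 2 V)
    (ν : ℝ) (𝒩 : Set (Euc d) → Set (Euc d))
    (h1 : Assumption1 V ν 𝒩) (h2 : Assumption2 V 𝒩)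
    (hco : Tendsto V (cocompact (Euc d)) atTop)
    (hmin0 : ∀ x, 0 ≤ V x) (hmin : ∃ x, V x = 0) :
    localMinSet V = {x | V x = 0} ∧ IsPreconnected {x | V x = 0} ∧
    ∃ N : Set (Euc d), IsOpen N ∧ {x | V x = 0} ⊆ N ∧ (∀ x ∈ N, ν * V x ≤ ‖gradient V x‖ ^ 2) ∧
      ∀ x ∉ N, gradient V x = 0 → ∀ v : Euc d, v ≠ 0 → hessQ V x v < 0 := by
  have hpc := min_preconnected hd hV (fun x hx => crit_class h1 h2 hmin0 hx) hco
  obtain ⟨x0, hx0⟩ := hmin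
  have hz : ∀ x, V x = 0 → x ∈ localMinSet V := fun x hx => by
    refine Eventually.of_forall fun y => ?_
    rw [hx]; exact hmin0 y
  have hcomp : ∀ x ∈ localMinSet V, connectedComponentIn (localMinSet V) x = localMinSet V :=
    fun x hx => hpc.connectedComponentIn hx
  have hN := h1.2 x0 (hz x0 hx0)
  rw [hcomp x0 (hz x0 hx0)] at hN
  obtain ⟨ho, hsub, -, hPL⟩ := hN
  have hinf : sInf (V '' 𝒩 (localMinSet V)) = 0 := by
    apply le_antisymm
    · exact csInf_le ⟨0, by rintro _ ⟨w, -, rfl⟩; exact hmin0 w⟩ ⟨x0, hsub (hz x0 hx0), hx0⟩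
    · exact le_csInf ⟨_, x0, hsub (hz x0 hx0), rfl⟩ (by rintro _ ⟨w, -, rfl⟩; exact hmin0 w)
  rw [hinf] at hPL
  simp only [sub_zero] at hPL
  have hS : localMinSet V = {x | V x = 0} := by
    apply Subset.antisymm _ hz
    intro x hx
    have := hPL x (hsub hx)
    rw [min_crit hx, norm_zero] at this
    have h := hmin0 x
    have hν := h1.1
    show V x = 0
    by_contra hne
    have : 0 < V x := lt_of_le_of_ne h (Ne.symm hne)
    nlinarith [mul_pos hν this]
  refine ⟨hS, hS ▸ hpc, 𝒩 (localMinSet V), ho, hS ▸ hsub, hPL, fun x hx => h2 x ?_⟩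
  simp only [NSet, mem_iUnion, not_exists]
  intro y hy
  rwa [hcomp y hy]

lemma lap_continuous {V : Euc d → ℝ} (hV : ContDiff ℝ 2 V) : Continuous (lap V) := by
  have h := (grad_contDiff1 hV).continuous_fderiv (by simp)
  unfold lap hessQ
  fun_prop

lemma div_parts {V h : Euc d → ℝ} (hV : ContDiff ℝ 2 V) (hh : ContDiff ℝ 1 h)
    (hc : HasCompactSupport h) :
    ∫ x, ⟪gradient h x, gradient V x⟫ = - ∫ x, h x * lap V x := by
  have hgV := grad_contDiff1 hV
  have hgh : Continuous (gradient h) := (grad_contDiff (n := 0) (by simpa using hh)).continuous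
  have hgc : HasCompactSupport (fderiv ℝ h) := hc.fderiv (𝕜 := ℝ)
  have hfh : Continuous (fderiv ℝ h) := hh.continuous_fderiv (by simp)
  have hfg : Continuous (fderiv ℝ (gradient V)) := hgV.continuous_fderiv (by simp)
  let b := EuclideanSpace.basisFun (Fin d) ℝ
  have e1 : ∀ x, ⟪gradient h x, gradient V x⟫ = ∑ i, ⟪gradient V x, b i⟫ * fderiv ℝ h x (b i) := by
    intro x
    rw [← b.sum_inner_mul_inner]
    refine Finset.sum_congr rfl fun i _ => ?_
    rw [grad_apply, real_inner_comm (gradient V x)]; ring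
  have hD : ∀ (x : Euc d) (i), fderiv ℝ (fun y => ⟪gradient V y, b i⟫) x (b i) = hessQ V x (b i) := by
    intro x i
    have hd := (hgV.differentiable (by simp) x).hasFDerivAt
    have := hd.inner ℝ (hasFDerivAt_const (b i) x)
    rw [this.fderiv]
    simp [hessQ]
  have hI1 : ∀ i, Integrable (fun x => ⟪gradient V x, b i⟫ * fderiv ℝ h x (b i)) := by
    intro i
    apply Continuous.integrable_of_hasCompactSupport
    · have := hgV.continuous; fun_prop
    · exact (hgc.comp_left (g := fun L : Euc d →L[ℝ] ℝ => L (b i)) (by simp)).mul_left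
  have hI2 : ∀ i, Integrable (fun x => hessQ V x (b i) * h x) := by
    intro i
    apply Continuous.integrable_of_hasCompactSupport
    · have := hh.continuous; unfold hessQ; fun_prop
    · exact hc.mul_left
  have hI3 : ∀ i, Integrable (fun x => ⟪gradient V x, b i⟫ * h x) := by
    intro i
    apply Continuous.integrable_of_hasCompactSupport
    · have := hh.continuous; have := hgV.continuous; fun_prop
    · exact hc.mul_left
  have key : ∀ i, ∫ x, ⟪gradient V x, b i⟫ * fderiv ℝ h x (b i) = - ∫ x, hessQ V x (b i) * h x := by
    intro i
    have := integral_mul_fderiv_eq_neg_fderiv_mul_of_integrable (μ := volume)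
      (f := fun y => ⟪gradient V y, b i⟫) (g := h) (v := b i)
      (by simpa only [hD] using hI2 i) (hI1 i) (hI3 i)
      (fun x _ => ((hgV.differentiable (by simp) x).inner ℝ (differentiableAt_const _)))
      (fun x _ => hh.differentiable (by simp) x)
    simpa only [hD] using this
  simp_rw [e1]
  rw [integral_finsetSum _ (fun i _ => hI1 i)]
  simp_rw [key]
  rw [Finset.sum_neg_distrib, ← integral_finsetSum _ (fun i _ => hI2 i)]
  congr 1
  refine integral_congr_ae (Eventually.of_forall fun x => ?_)
  simp only [lap, ← Finset.sum_mul]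
  rw [mul_comm]

lemma lyap0 {V u : Euc d → ℝ} (hV : ContDiff ℝ 2 V) (hu : ContDiff ℝ 1 u)
    (hc : HasCompactSupport u) {ε : ℝ} (hε : 0 < ε) :
    ∫ x, u x ^ 2 * (‖gradient V x‖ ^ 2 / (4 * ε) - lap V x / 2) * exp (-V x / ε) ≤
      ε * ∫ x, ‖gradient u x‖ ^ 2 * exp (-V x / ε) := by
  have hV1 : ContDiff ℝ 1 V := hV.of_le (by norm_num)
  have hgV := (grad_contDiff1 hV).continuous
  have hgu : Continuous (gradient u) := (grad_contDiff (n := 0) (by simpa using hu)).continuous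
  have hlap := lap_continuous hV
  have hVc := hV.continuous
  have huc := hu.continuous
  set w : Euc d → ℝ := fun x => exp (-V x / ε) with hw
  have hwC : ContDiff ℝ 1 w := by fun_prop
  have hwc := hwC.continuous
  set h : Euc d → ℝ := fun x => u x ^ 2 * w x with hh
  have hhC : ContDiff ℝ 1 h := by fun_prop
  have hcs2 : HasCompactSupport (fun x => u x ^ 2) := hc.comp_left (g := fun t : ℝ => t ^ 2) (by simp)
  have hhs : HasCompactSupport h := hcs2.mul_right
  have hgc : HasCompactSupport (gradient u) := by
    have := (hc.fderiv (𝕜 := ℝ)).comp_left (g := (InnerProductSpace.toDual ℝ (Euc d)).symm) (by simp)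
    exact this
  have hdiv := div_parts hV hhC hhs
  have hgradh : ∀ x, ⟪gradient h x, gradient V x⟫ =
      2 * u x * ⟪gradient u x, gradient V x⟫ * w x - u x ^ 2 * ‖gradient V x‖ ^ 2 * w x / ε := by
    intro x
    rw [← grad_apply]
    have hdu := (hu.differentiable (by simp) x).hasFDerivAt
    have hdV := (hV1.differentiable (by simp) x).hasFDerivAt
    have h1 : HasFDerivAt w (w x • (-(ε⁻¹ • fderiv ℝ V x))) x := by
      have : HasFDerivAt (fun y => -V y / ε) (-(ε⁻¹ • fderiv ℝ V x)) x := by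
        have := (hdV.neg.const_smul ε⁻¹)
        simp only [smul_neg] at this
        refine this.congr_of_eventuallyEq (Eventually.of_forall fun y => ?_)
        simp [div_eq_inv_mul]
      exact this.exp
    have h2 := (hdu.pow 2).mul h1
    have h3 : fderiv ℝ h x = _ := h2.fderiv
    rw [h3]
    simp only [ContinuousLinearMap.add_apply, ContinuousLinearMap.smul_apply, ContinuousLinearMap.neg_apply,
      grad_apply, smul_eq_mul, real_inner_self_eq_norm_sq]
    simp
    field_simp
    ring
  have hpt : ∀ x, u x ^ 2 * (‖gradient V x‖ ^ 2 / (4 * ε)) * w x + (1/2) * ⟪gradient h x, gradient V x⟫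
      ≤ ε * (‖gradient u x‖ ^ 2 * w x) := by
    intro x
    rw [hgradh]
    have hw0 : 0 ≤ w x := (exp_pos _).le
    have h1 : 0 ≤ ‖gradient u x - (u x / (2 * ε)) • gradient V x‖ ^ 2 := sq_nonneg _
    rw [norm_sub_sq_real, inner_smul_right, norm_smul, mul_pow, Real.norm_eq_abs, sq_abs] at h1
    have h2 := mul_nonneg (mul_nonneg hε.le h1) hw0
    have e : ε * (‖gradient u x‖ ^ 2 - 2 * (u x / (2 * ε) * ⟪gradient u x, gradient V x⟫) +
        (u x / (2 * ε)) ^ 2 * ‖gradient V x‖ ^ 2) * w x =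
        ε * (‖gradient u x‖ ^ 2 * w x) - (u x ^ 2 * (‖gradient V x‖ ^ 2 / (4 * ε)) * w x + (1/2) *
        (2 * u x * ⟪gradient u x, gradient V x⟫ * w x - u x ^ 2 * ‖gradient V x‖ ^ 2 * w x / ε)) := by
      field_simp
      ring
    linarith
  have I1 : Integrable (fun x => u x ^ 2 * (‖gradient V x‖ ^ 2 / (4 * ε)) * w x) := by
    apply Continuous.integrable_of_hasCompactSupport
    · fun_prop
    · exact hcs2.mul_right.mul_right
  have I2 : Integrable (fun x => ⟪gradient h x, gradient V x⟫) := by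
    simp_rw [hgradh]
    apply Continuous.integrable_of_hasCompactSupport
    · fun_prop
    · refine HasCompactSupport.sub ?_ ?_
      · exact (hc.mul_left.mul_right).mul_right
      · simp_rw [div_eq_mul_inv]
        exact ((hcs2.mul_right).mul_right).mul_right
  have I3 : Integrable (fun x => ‖gradient u x‖ ^ 2 * w x) := by
    apply Continuous.integrable_of_hasCompactSupport
    · fun_prop
    · exact (hgc.comp_left (g := fun v : Euc d => ‖v‖ ^ 2) (by simp)).mul_right
  have I4 : Integrable (fun x => h x * lap V x) := by
    apply Continuous.integrable_of_hasCompactSupport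
    · fun_prop
    · exact hhs.mul_right
  have hint := integral_mono (I1.add (I2.const_mul (1/2))) (I3.const_mul ε) hpt
  have e1 : ∫ x, (u x ^ 2 * (‖gradient V x‖ ^ 2 / (4 * ε)) * w x + (1/2) * ⟪gradient h x, gradient V x⟫) =
     ∫ x, u x ^ 2 * (‖gradient V x‖ ^ 2 / (4 * ε) - lap V x / 2) * w x := by
    rw [integral_add I1 (I2.const_mul _), integral_const_mul, hdiv,
      show (1/2 : ℝ) * -∫ x, h x * lap V x = ∫ x, (-(1/2) : ℝ) * (h x * lap V x) by
        rw [integral_const_mul]; ring, ← integral_add I1 (I4.const_mul _)]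
    refine integral_congr_ae (Eventually.of_forall fun x => ?_)
    simp only [hh]; ring
  rw [← e1, ← integral_const_mul]
  exact hint

lemma phi_bound (hd : 2 ≤ d) {V : Euc d → ℝ} (hV : ContDiff ℝ 2 V) {ν R₀ ν_eb C_g : ℝ} (hν : 0 < ν)
    (h3 : Assumption3 V R₀ ν_eb C_g) (hne : (localMinSet V).Nonempty)
    {N : Set (Euc d)} (hN : IsOpen N) (hPL : ∀ x ∈ N, ν * V x ≤ ‖gradient V x‖ ^ 2)
    (hND : ∀ x ∉ N, gradient V x = 0 → ∀ v : Euc d, v ≠ 0 → hessQ V x v < 0) :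
    ∃ a > 0, ∃ c > 0, ∃ B ≥ 0, ∃ ε₁ > 0, ∀ ε : ℝ, 0 < ε → ε ≤ ε₁ → ∀ x : Euc d,
      (c ≤ ‖gradient V x‖ ^ 2 / (4 * ε) - lap V x / 2) ∨
      (V x ≤ a * ε ∧ -B ≤ ‖gradient V x‖ ^ 2 / (4 * ε) - lap V x / 2) := by
  obtain ⟨hR, hneb, hCg, hgrow, hco, hSR⟩ := h3
  have hlap := lap_continuous hV
  have hgc := (grad_contDiff1 hV).continuous
  set R := 2 * R₀ + 1
  have hKc : IsCompact (closedBall (0 : Euc d) R) := isCompact_closedBall _ _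
  obtain ⟨B, hB⟩ := hKc.exists_bound_of_continuousOn hlap.continuousOn
  have hB0 : 0 ≤ B := (norm_nonneg _).trans (hB 0 (by simp [R]; positivity))
  set a : ℝ := 4 * (B / 2 + 1) / ν
  have ha : 0 < a := by positivity
  let p : Set (Euc d) → Prop := fun s => ∃ c > 0, ∃ ε₁ > 0, ∀ ε : ℝ, 0 < ε → ε ≤ ε₁ → ∀ x ∈ s,
    x ∈ closedBall (0 : Euc d) R → a * ε < V x → c ≤ ‖gradient V x‖ ^ 2 / (4 * ε) - lap V x / 2
  have hp : p (closedBall (0 : Euc d) R) := by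
    apply hKc.induction_on (p := p)
    · exact ⟨1, one_pos, 1, one_pos, fun _ _ _ x hx => absurd hx (notMem_empty x)⟩
    · rintro s t hst ⟨c, hc, e, he, h⟩
      exact ⟨c, hc, e, he, fun ε h0 h1 x hx => h ε h0 h1 x (hst hx)⟩
    · rintro s t ⟨c, hc, e, he, h⟩ ⟨c', hc', e', he', h'⟩
      refine ⟨min c c', lt_min hc hc', min e e', lt_min he he', fun ε h0 h1 x hx hxR hxa => ?_⟩
      rcases hx with hx | hx
      · exact (min_le_left _ _).trans (h ε h0 (h1.trans (min_le_left _ _)) x hx hxR hxa)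
      · exact (min_le_right _ _).trans (h' ε h0 (h1.trans (min_le_right _ _)) x hx hxR hxa)
    · intro x hx
      by_cases hxN : x ∈ N
      · refine ⟨N, mem_nhdsWithin_of_mem_nhds (hN.mem_nhds hxN), 1, one_pos, 1, one_pos,
          fun ε h0 h1 y hy hyR hya => ?_⟩
        have h2 := hPL y hy
        have h4 : a * ε * ν ≤ ‖gradient V y‖ ^ 2 := by nlinarith
        have h5 : B / 2 + 1 ≤ ‖gradient V y‖ ^ 2 / (4 * ε) := by
          rw [le_div_iff₀ (by positivity)]
          have : a * ν = 4 * (B / 2 + 1) := by simp only [a]; field_simp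
          nlinarith
        have h6 := (le_abs_self _).trans (hB y hyR)
        linarith
      · by_cases hg : gradient V x = 0
        · have hneg : lap V x < 0 := by
            unfold lap
            apply Finset.sum_neg
            · intro i _
              exact hND x hxN hg _ (by
                have := (EuclideanSpace.basisFun (Fin d) ℝ).norm_eq_one i
                intro h0; rw [h0] at this; simp at this)
            · exact ⟨⟨0, by omega⟩, Finset.mem_univ _⟩
          have : ∀ᶠ y in 𝓝 x, lap V y < lap V x / 2 :=
            hlap.continuousAt.eventually (gt_mem_nhds (by linarith))
          refine ⟨_, mem_nhdsWithin_of_mem_nhds this, -lap V x / 4, by linarith, 1, one_pos,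
            fun ε h0 h1 y hy hyR hya => ?_⟩
          have h5 : 0 ≤ ‖gradient V y‖ ^ 2 / (4 * ε) := by positivity
          have hy' : lap V y < lap V x / 2 := hy
          linarith
        · have hn : 0 < ‖gradient V x‖ ^ 2 := by have := norm_pos_iff.2 hg; positivity
          set G := ‖gradient V x‖ ^ 2
          have : ∀ᶠ y in 𝓝 x, G / 2 < ‖gradient V y‖ ^ 2 :=
            (by fun_prop : Continuous (fun y => ‖gradient V y‖ ^ 2)).continuousAt.eventually
              (lt_mem_nhds (show G / 2 < G by linarith))
          refine ⟨_, mem_nhdsWithin_of_mem_nhds this, 1, one_pos, G / (8 * (B / 2 + 1)), by positivity,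
            fun ε h0 h1 y hy hyR hya => ?_⟩
          have hy' : G / 2 < ‖gradient V y‖ ^ 2 := hy
          have h5 : B / 2 + 1 ≤ ‖gradient V y‖ ^ 2 / (4 * ε) := by
            rw [le_div_iff₀ (by positivity)]
            rw [le_div_iff₀ (by positivity)] at h1
            nlinarith
          have h6 := (le_abs_self _).trans (hB y hyR)
          linarith
  obtain ⟨c, hc, e, he, h⟩ := hp
  refine ⟨a, ha, min c 1, lt_min hc one_pos, B / 2, by positivity,
    min e (ν_eb ^ 2 / (16 * (C_g / 2 + 1))), lt_min he (by positivity), fun ε h0 h1 x => ?_⟩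
  by_cases hxR : x ∈ closedBall (0 : Euc d) R
  · by_cases hxa : V x ≤ a * ε
    · right
      refine ⟨hxa, ?_⟩
      have h6 := (le_abs_self _).trans (hB x hxR)
      have h5 : 0 ≤ ‖gradient V x‖ ^ 2 / (4 * ε) := by positivity
      linarith
    · left
      exact (min_le_left _ _).trans (h ε h0 (h1.trans (min_le_left _ _)) x hxR hxR (not_le.1 hxa))
  · left
    refine (min_le_right _ _).trans ?_
    rw [mem_closedBall, dist_zero_right, not_le] at hxR
    have hx1 : 1 ≤ ‖x‖ := by simp only [R] at hxR; linarith
    obtain ⟨g1, g2⟩ := hgrow x (by simp only [R] at hxR; linarith)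
    have hdist : ‖x‖ / 2 ≤ infDist x (localMinSet V) := by
      rw [le_infDist hne]
      intro y hy
      have hy' := hSR hy
      rw [mem_closedBall, dist_zero_right] at hy'
      have := norm_sub_norm_le x y
      rw [dist_eq_norm]
      simp only [R] at hxR
      linarith
    have g3 : ν_eb * (‖x‖ / 2) ≤ ‖gradient V x‖ := (mul_le_mul_of_nonneg_left hdist hneb.le).trans g1
    have g4 : (ν_eb * (‖x‖ / 2)) ^ 2 ≤ ‖gradient V x‖ ^ 2 := by gcongr
    have g5 : (C_g / 2 + 1) * ‖x‖ ^ 2 ≤ ‖gradient V x‖ ^ 2 / (4 * ε) := by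
      rw [le_div_iff₀ (by positivity)]
      have h2 := h1.trans (min_le_right _ _)
      rw [le_div_iff₀ (by positivity)] at h2
      nlinarith [sq_nonneg ‖x‖, mul_le_mul_of_nonneg_right h2 (sq_nonneg ‖x‖)]
    have g6 := (le_abs_self _).trans g2
    have : 1 ≤ ‖x‖ ^ 2 := by nlinarith
    nlinarith

lemma cutoff_seq : ∃ K : ℝ, ∃ χ : ℕ → Euc d → ℝ, (∀ n, ContDiff ℝ 1 (χ n)) ∧
    (∀ n, HasCompactSupport (χ n)) ∧ (∀ n x, 0 ≤ χ n x ∧ χ n x ≤ 1) ∧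
    (∀ n x, ‖gradient (χ n) x‖ ≤ K * (1 / ((n:ℝ) + 1))) ∧ (∀ x, ∀ᶠ n in atTop, χ n x = 1) := by
  let b : ContDiffBump (0 : Euc d) := ⟨1, 2, one_pos, one_lt_two⟩
  have hbC : ContDiff ℝ 1 b := b.contDiff
  have hbs : HasCompactSupport b := b.hasCompactSupport
  have hcf : Continuous (fderiv ℝ b) := hbC.continuous_fderiv (by simp)
  obtain ⟨K, hK⟩ := hcf.bounded_above_of_compact_support (hbs.fderiv (𝕜 := ℝ))
  have hpos : ∀ n : ℕ, (0:ℝ) < 1 / ((n:ℝ) + 1) := fun n => by positivity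
  refine ⟨K, fun n x => b ((1 / ((n:ℝ) + 1)) • x), fun n => ?_, fun n => ?_, fun n x => ⟨b.nonneg, b.le_one⟩, fun n x => ?_, fun x => ?_⟩
  · exact hbC.comp (contDiff_const_smul _)
  · exact hbs.comp_homeomorph (Homeomorph.smulOfNeZero _ (hpos n).ne')
  · rw [norm_grad]
    have h1 : HasFDerivAt (fun x : Euc d => (1 / ((n:ℝ) + 1)) • x) ((1 / ((n:ℝ) + 1)) • ContinuousLinearMap.id ℝ (Euc d)) x :=
      ((1 / ((n:ℝ) + 1)) • ContinuousLinearMap.id ℝ (Euc d)).hasFDerivAt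
    have h2 := ((hbC.differentiable (by simp)) ((1 / ((n:ℝ) + 1)) • x)).hasFDerivAt.comp x h1
    have h3 : fderiv ℝ (fun x => b ((1 / ((n:ℝ) + 1)) • x)) x = _ := h2.fderiv
    rw [h3]
    have h4 : (fderiv ℝ b ((1 / ((n:ℝ) + 1)) • x)).comp ((1 / ((n:ℝ) + 1)) • ContinuousLinearMap.id ℝ (Euc d)) =
      (1 / ((n:ℝ) + 1)) • fderiv ℝ b ((1 / ((n:ℝ) + 1)) • x) := by
      ext v; simp
    rw [h4, norm_smul, Real.norm_of_nonneg (hpos n).le, mul_comm]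
    exact mul_le_mul_of_nonneg_right (hK _) (hpos n).le
  · filter_upwards [(tendsto_natCast_atTop_atTop (R := ℝ)).eventually (eventually_ge_atTop ‖x‖)] with n hn
    apply b.one_of_mem_closedBall
    rw [mem_closedBall, dist_zero_right, norm_smul, Real.norm_of_nonneg (hpos n).le]
    show 1 / ((n:ℝ) + 1) * ‖x‖ ≤ 1
    rw [one_div, inv_mul_le_iff₀ (by positivity)]
    linarith

lemma lyap {V f : Euc d → ℝ} (hV : ContDiff ℝ 2 V) (hf : ContDiff ℝ 1 f) {ε a c B : ℝ} (hε : 0 < ε)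
    (hc : 0 < c) (hB : 0 ≤ B)
    (hphi : ∀ x : Euc d, (c ≤ ‖gradient V x‖ ^ 2 / (4 * ε) - lap V x / 2) ∨
      (V x ≤ a * ε ∧ -B ≤ ‖gradient V x‖ ^ 2 / (4 * ε) - lap V x / 2))
    (hf2 : Integrable (fun x => f x ^ 2 * exp (-V x / ε)))
    (hg2 : Integrable (fun x => ‖gradient f x‖ ^ 2 * exp (-V x / ε))) :
    c * ∫ x, f x ^ 2 * exp (-V x / ε) ≤ 2 * ε * (∫ x, ‖gradient f x‖ ^ 2 * exp (-V x / ε)) +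
      (B + c) * ∫ x in {x | V x ≤ a * ε}, f x ^ 2 * exp (-V x / ε) := by
  obtain ⟨K, χ, hχC, hχs, hχ01, hχg, hχ1⟩ := cutoff_seq (d := d)
  have hVc := hV.continuous
  have hfc := hf.continuous
  have hgV := (grad_contDiff1 hV).continuous
  have hlap := lap_continuous hV
  set w : Euc d → ℝ := fun x => exp (-V x / ε) with hw
  have hwc : Continuous w := by fun_prop
  have hw0 : ∀ x, 0 ≤ w x := fun x => (exp_pos _).le
  set A : Set (Euc d) := {x | V x ≤ a * ε}
  have hA : MeasurableSet A := measurableSet_le hVc.measurable measurable_const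
  have key : ∀ n, c * ∫ x, (χ n x * f x) ^ 2 * w x ≤
      2 * ε * (∫ x, ‖gradient f x‖ ^ 2 * w x) + (B + c) * (∫ x in A, f x ^ 2 * w x)
      + 2 * ε * (K * (1 / ((n:ℝ) + 1))) ^ 2 * ∫ x, f x ^ 2 * w x := by
    intro n
    set u : Euc d → ℝ := fun x => χ n x * f x with hu
    have huC : ContDiff ℝ 1 u := (hχC n).mul hf
    have hus : HasCompactSupport u := (hχs n).mul_right
    have hL := lyap0 hV huC hus hε
    have huc := huC.continuous
    have hus2 : HasCompactSupport (fun x => u x ^ 2) := hus.comp_left (g := fun t : ℝ => t ^ 2) (by simp)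
    have J1 : Integrable (fun x => u x ^ 2 * w x) := by
      apply Continuous.integrable_of_hasCompactSupport (by fun_prop) hus2.mul_right
    have J2 : Integrable (fun x => u x ^ 2 * (‖gradient V x‖ ^ 2 / (4 * ε) - lap V x / 2) * w x) := by
      apply Continuous.integrable_of_hasCompactSupport (by fun_prop) hus2.mul_right.mul_right
    have J3 : Integrable (A.indicator (fun x => f x ^ 2 * w x)) := hf2.indicator hA
    have hu2 : ∀ x, u x ^ 2 ≤ f x ^ 2 := by
      intro x
      rw [hu]; simp only [mul_pow]
      have := hχ01 n x
      have h1 : χ n x ^ 2 ≤ 1 := by nlinarith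
      nlinarith [sq_nonneg (f x)]
    have p1 : ∀ x, c * (u x ^ 2 * w x) - (B + c) * A.indicator (fun x => f x ^ 2 * w x) x ≤
        u x ^ 2 * (‖gradient V x‖ ^ 2 / (4 * ε) - lap V x / 2) * w x := by
      intro x
      have hq : 0 ≤ u x ^ 2 * w x := mul_nonneg (sq_nonneg _) (hw0 x)
      have hq2 : u x ^ 2 * w x ≤ f x ^ 2 * w x := mul_le_mul_of_nonneg_right (hu2 x) (hw0 x)
      have hi : 0 ≤ A.indicator (fun x => f x ^ 2 * w x) x :=
        indicator_nonneg (fun y _ => mul_nonneg (sq_nonneg _) (hw0 y)) x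
      rcases hphi x with h | ⟨h1, h2⟩
      · have := mul_le_mul_of_nonneg_right h hq
        have := mul_nonneg (by linarith : 0 ≤ B + c) hi
        linarith
      · have := mul_le_mul_of_nonneg_right h2 hq
        rw [indicator_of_mem (show x ∈ A from h1)]
        have := mul_le_mul_of_nonneg_left hq2 (by linarith : 0 ≤ B + c)
        linarith
    have i1 := integral_mono ((J1.const_mul c).sub (J3.const_mul (B + c))) J2 p1
    simp only [Pi.sub_apply] at i1
    rw [integral_sub (J1.const_mul c) (J3.const_mul (B + c)), integral_const_mul, integral_const_mul,
      integral_indicator hA] at i1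
    have p2 : ∀ x, ‖gradient u x‖ ^ 2 * w x ≤ 2 * (‖gradient f x‖ ^ 2 * w x) +
        2 * (K * (1 / ((n:ℝ) + 1))) ^ 2 * (f x ^ 2 * w x) := by
      intro x
      have hgu : gradient u x = χ n x • gradient f x + f x • gradient (χ n) x := by
        have := fderiv_mul ((hχC n).differentiable (by simp) x) (hf.differentiable (by simp) x)
        have h' : fderiv ℝ u x = χ n x • fderiv ℝ f x + f x • fderiv ℝ (χ n) x := this
        simp [gradient, h']
      have n1 : ‖gradient u x‖ ≤ ‖gradient f x‖ + |f x| * (K * (1 / ((n:ℝ) + 1))) := by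
        rw [hgu]
        refine (norm_add_le _ _).trans ?_
        rw [norm_smul, norm_smul, Real.norm_of_nonneg (hχ01 n x).1, Real.norm_eq_abs]
        refine add_le_add ?_ (mul_le_mul_of_nonneg_left (hχg n x) (abs_nonneg _))
        exact mul_le_of_le_one_left (norm_nonneg _) (hχ01 n x).2
      have n2 : ‖gradient u x‖ ^ 2 ≤ 2 * ‖gradient f x‖ ^ 2 + 2 * (K * (1 / ((n:ℝ) + 1))) ^ 2 * f x ^ 2 := by
        have : ‖gradient u x‖ ^ 2 ≤ (‖gradient f x‖ + |f x| * (K * (1 / ((n:ℝ) + 1)))) ^ 2 := by gcongr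
        rw [← sq_abs (f x)]
        nlinarith [sq_nonneg (‖gradient f x‖ - |f x| * (K * (1 / ((n:ℝ) + 1))))]
      have := mul_le_mul_of_nonneg_right n2 (hw0 x)
      linarith
    have hgu : Continuous (gradient u) := (grad_contDiff (n := 0) (by simpa using huC)).continuous
    have hgc : HasCompactSupport (gradient u) := by
      have := (hus.fderiv (𝕜 := ℝ)).comp_left (g := (InnerProductSpace.toDual ℝ (Euc d)).symm) (by simp)
      exact this
    have J4 : Integrable (fun x => ‖gradient u x‖ ^ 2 * w x) := by
      apply Continuous.integrable_of_hasCompactSupport (by fun_prop)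
      exact (hgc.comp_left (g := fun v : Euc d => ‖v‖ ^ 2) (by simp)).mul_right
    have i2 := integral_mono J4 ((hg2.const_mul 2).add (hf2.const_mul (2 * (K * (1 / ((n:ℝ) + 1))) ^ 2))) p2
    simp only [Pi.add_apply] at i2
    rw [integral_add (hg2.const_mul 2) (hf2.const_mul _), integral_const_mul, integral_const_mul] at i2
    have i3 := mul_le_mul_of_nonneg_left i2 hε.le
    have hL' : ∫ x, u x ^ 2 * (‖gradient V x‖ ^ 2 / (4 * ε) - lap V x / 2) * w x ≤
      ε * ∫ x, ‖gradient u x‖ ^ 2 * w x := hL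
    linarith
  have hlim1 : Tendsto (fun n => ∫ x, (χ n x * f x) ^ 2 * w x) atTop (𝓝 (∫ x, f x ^ 2 * w x)) := by
    apply tendsto_integral_of_dominated_convergence (fun x => f x ^ 2 * w x)
    · intro n
      have := (hχC n).continuous
      exact (by fun_prop : Continuous (fun x => (χ n x * f x) ^ 2 * w x)).aestronglyMeasurable
    · exact hf2
    · intro n
      refine Eventually.of_forall fun x => ?_
      rw [Real.norm_of_nonneg (mul_nonneg (sq_nonneg _) (hw0 x))]
      refine mul_le_mul_of_nonneg_right ?_ (hw0 x)
      have := hχ01 n x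
      have h1 : χ n x ^ 2 ≤ 1 := by nlinarith
      rw [mul_pow]
      nlinarith [sq_nonneg (f x)]
    · refine Eventually.of_forall fun x => ?_
      apply tendsto_const_nhds.congr'
      filter_upwards [hχ1 x] with n hn
      rw [hn, one_mul]
  have hlim2 : Tendsto (fun n : ℕ => 2 * ε * (∫ x, ‖gradient f x‖ ^ 2 * w x) + (B + c) * (∫ x in A, f x ^ 2 * w x)
      + 2 * ε * (K * (1 / ((n:ℝ) + 1))) ^ 2 * ∫ x, f x ^ 2 * w x) atTop (𝓝
      (2 * ε * (∫ x, ‖gradient f x‖ ^ 2 * w x) + (B + c) * (∫ x in A, f x ^ 2 * w x)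
      + 2 * ε * (K * 0) ^ 2 * ∫ x, f x ^ 2 * w x)) := by
    have := tendsto_one_div_add_atTop_nhds_zero_nat (𝕜 := ℝ)
    exact ((((this.const_mul K).pow 2).const_mul (2 * ε)).mul_const _).const_add _
  have := le_of_tendsto_of_tendsto' (hlim1.const_mul c) hlim2 key
  simpa using this

lemma chart0 {V : Euc d → ℝ} (hV : ContDiff ℝ 2 V) {x0 : Euc d} (hg : gradient V x0 = 0) :
    ∃ (P : Euc d →L[ℝ] Euc d) (G : Euc d → Euc d) (ρ : ℝ), 0 < ρ ∧ (∀ w, P (P w) = P w) ∧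
      (∀ u v, ⟪P u, v⟫ = ⟪u, P v⟫) ∧ (∀ w, ‖P w‖ ≤ ‖w‖) ∧ G 0 = x0 ∧
      (∀ w ∈ ball (0 : Euc d) ρ, ContDiffAt ℝ 1 G w) ∧ InjOn G (ball 0 ρ) ∧
      (∀ O ⊆ ball (0 : Euc d) ρ, IsOpen O → IsOpen (G '' O)) ∧
      (∀ w ∈ ball (0 : Euc d) ρ, P (G w - x0) = P w ∧
        gradient V (G w) - P (gradient V (G w)) = w - P w) ∧
      (fderiv ℝ G 0).det ≠ 0 ∧ (∀ w, fderiv ℝ (gradient V) x0 (fderiv ℝ G 0 (P w)) = 0) := by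
  set g := gradient V with hgdef
  have hgC : ContDiff ℝ 1 g := grad_contDiff1 hV
  set H := fderiv ℝ g x0 with hH
  set K : Submodule ℝ (Euc d) := LinearMap.ker (H : Euc d →ₗ[ℝ] Euc d) with hK
  set P := K.starProjection with hP
  have hPP : ∀ w, P (P w) = P w := fun w =>
    Submodule.starProjection_eq_self_iff.2 (K.starProjection_apply_mem w)
  have hPs : ∀ u v, ⟪P u, v⟫ = ⟪u, P v⟫ := fun u v => K.inner_starProjection_left_eq_right u v
  have hHP : ∀ w, H (P w) = 0 := fun w => by
    have := LinearMap.mem_ker.1 (K.starProjection_apply_mem w)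
    exact this
  have hsym : ∀ v w, ⟪H v, w⟫ = ⟪H w, v⟫ := fun v w => hess_symm hV x0 v w
  have hPH : ∀ w, P (H w) = 0 := fun w => by
    apply ext_inner_right ℝ
    intro v
    rw [hPs, hsym, hHP]; simp
  let F : Euc d → Euc d := fun x => P (x - x0) + (g x - P (g x))
  have hFC : ContDiff ℝ 1 F := by
    have : ContDiff ℝ 1 (P : Euc d → Euc d) := P.contDiff
    exact (this.comp (contDiff_id.sub contDiff_const)).add (hgC.sub (this.comp hgC))
  have hgd : HasFDerivAt g H x0 := (hgC.differentiable (by simp) x0).hasFDerivAt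
  let A0 : Euc d →L[ℝ] Euc d := P + H
  have hFd : HasFDerivAt F A0 x0 := by
    have h1 : HasFDerivAt (fun x : Euc d => P (x - x0)) P x0 := by
      have := P.hasFDerivAt.comp x0 ((hasFDerivAt_id (𝕜 := ℝ) x0).sub_const x0)
      exact this
    have h2 : HasFDerivAt (fun x => P (g x)) (P.comp H) x0 := P.hasFDerivAt.comp x0 hgd
    have h3 := h1.add (hgd.sub h2)
    have h4 : P + (H - P.comp H) = A0 := by
      ext1 v; simp [A0, hPH]
    rw [h4] at h3
    exact h3
  have hinj : Function.Injective (A0 : Euc d →ₗ[ℝ] Euc d) := by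
    rw [← LinearMap.ker_eq_bot, LinearMap.ker_eq_bot']
    intro v hv
    have hv' : P v + H v = 0 := hv
    have h1 : P v = 0 := by
      have := congrArg P hv'
      rw [map_add, hPP, hPH] at this
      simpa using this
    have h2 : H v = 0 := by simpa [h1] using hv'
    have h3 : v ∈ K := by rw [hK, LinearMap.mem_ker]; exact h2
    have := Submodule.starProjection_eq_self_iff.2 h3
    rw [← this]; exact h1
  let A : Euc d ≃L[ℝ] Euc d := (LinearEquiv.ofInjectiveEndo (A0 : Euc d →ₗ[ℝ] Euc d) hinj).toContinuousLinearEquiv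
  have hAA : (A : Euc d →L[ℝ] Euc d) = A0 := by ext1 v; rfl
  have hFd' : HasFDerivAt F (A : Euc d →L[ℝ] Euc d) x0 := by rw [hAA]; exact hFd
  have hF0 : F x0 = 0 := by simp [F, hg]
  let e := (hFC.contDiffAt (x := x0)).toOpenPartialHomeomorph F hFd' one_ne_zero
  have he : ∀ x, e x = F x := fun x => rfl
  have hes : x0 ∈ e.source := ContDiffAt.mem_toOpenPartialHomeomorph_source _ hFd' one_ne_zero
  have het : (0 : Euc d) ∈ e.target := by
    have := e.map_source hes
    rwa [he, hF0] at this
  let G := e.symm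
  have hG0 : G 0 = x0 := by
    have := e.left_inv hes
    rwa [he, hF0] at this
  have hGC : ContDiffAt ℝ 1 G 0 := by
    have := ContDiffAt.to_localInverse (hFC.contDiffAt (x := x0)) hFd' one_ne_zero
    rw [hF0] at this
    exact this
  have hev : ∀ᶠ w in 𝓝 (0 : Euc d), ContDiffAt ℝ 1 G w ∧ w ∈ e.target :=
    (hGC.eventually (by simp)).and (e.open_target.mem_nhds het)
  obtain ⟨ρ, hρ, hball⟩ := Metric.eventually_nhds_iff_ball.1 hev
  have hFG : ∀ w ∈ ball (0 : Euc d) ρ, F (G w) = w := fun w hw => e.right_inv (hball w hw).2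
  have hcomp : ∀ v, A0 (fderiv ℝ G 0 v) = v := by
    have h1 : HasFDerivAt (fun w => F (G w)) (A0.comp (fderiv ℝ G 0)) 0 := by
      have h2 : HasFDerivAt F A0 (G 0) := by rw [hG0]; exact hFd
      exact h2.comp 0 (hGC.differentiableAt (by simp)).hasFDerivAt
    have h3 : HasFDerivAt (fun w => F (G w)) (ContinuousLinearMap.id ℝ (Euc d)) 0 := by
      apply (hasFDerivAt_id (𝕜 := ℝ) (0 : Euc d)).congr_of_eventuallyEq
      filter_upwards [ball_mem_nhds _ hρ] with w hw
      exact hFG w hw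
    have := h1.unique h3
    intro v
    simpa using congrArg (fun B : Euc d →L[ℝ] Euc d => B v) this
  refine ⟨P, G, ρ, hρ, hPP, hPs, fun w => K.norm_starProjection_apply_le w, hG0, fun w hw => (hball w hw).1, ?_, ?_, ?_, ?_, ?_⟩
  · exact fun w hw w' hw' h => by rw [← hFG w hw, ← hFG w' hw', h]
  · intro O hO hOo
    exact e.isOpen_image_symm_of_subset_target hOo (fun w hw => (hball w (hO hw)).2)
  · intro w hw
    have h := hFG w hw
    simp only [F] at h
    have h1 : P (G w - x0) = P w := by
      have := congrArg P h
      rw [map_add, hPP, map_sub P (g (G w)), hPP, sub_self, add_zero] at this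
      exact this
    refine ⟨h1, ?_⟩
    rw [h1] at h
    rw [eq_sub_iff_add_eq, add_comm]; exact h
  · have h1 : A0.comp (fderiv ℝ G 0) = ContinuousLinearMap.id ℝ _ := by ext1 v; exact hcomp v
    have h2 := congrArg (fun B : Euc d →L[ℝ] Euc d => LinearMap.det (B : Euc d →ₗ[ℝ] Euc d)) h1
    have h3 : ((A0.comp (fderiv ℝ G 0) : Euc d →L[ℝ] Euc d) : Euc d →ₗ[ℝ] Euc d) =
      (A0 : Euc d →ₗ[ℝ] Euc d).comp (fderiv ℝ G 0 : Euc d →ₗ[ℝ] Euc d) := rfl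
    simp only [h3, LinearMap.det_comp, ContinuousLinearMap.coe_id, LinearMap.det_id] at h2
    intro h0
    have h0' : LinearMap.det (fderiv ℝ G 0 : Euc d →ₗ[ℝ] Euc d) = 0 := h0
    rw [h0'] at h2; simp at h2
  · intro w
    have h1 : P (fderiv ℝ G 0 (P w)) + H (fderiv ℝ G 0 (P w)) = P w := hcomp (P w)
    have h2 := congrArg P h1
    rw [map_add, hPP, hPH, hPP, add_zero] at h2
    rw [h2] at h1
    simpa using h1

lemma chart1 {V : Euc d → ℝ} (hV : ContDiff ℝ 2 V) (h0 : ∀ x, 0 ≤ V x) {ν : ℝ} (hν : 0 < ν)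
    {N : Set (Euc d)} (hN : IsOpen N) (hPL : ∀ x ∈ N, ν * V x ≤ ‖gradient V x‖ ^ 2)
    {x0 : Euc d} (hx0N : x0 ∈ N) (hx0 : V x0 = 0) :
    ∃ (P : Euc d →L[ℝ] Euc d) (G : Euc d → Euc d) (ρ C : ℝ), 0 < ρ ∧ 0 < C ∧ (∀ w, P (P w) = P w) ∧
      (∀ w, ‖P w‖ ≤ ‖w‖) ∧ G 0 = x0 ∧
      (∀ w ∈ ball (0 : Euc d) ρ, ContDiffAt ℝ 1 G w ∧ ‖fderiv ℝ G w‖ ≤ C ∧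
        |(fderiv ℝ G w).det| ≤ C ∧ 1 ≤ C * |(fderiv ℝ G w).det| ∧
        ‖w - P w‖ ^ 2 ≤ C * V (G w) ∧ V (G w) ≤ C * ‖w - P w‖ ^ 2) ∧ InjOn G (ball 0 ρ) ∧
      (∀ O ⊆ ball (0 : Euc d) ρ, IsOpen O → IsOpen (G '' O)) := by
  have hgz : ∀ x, V x = 0 → gradient V x = 0 := by
    intro x hx
    have : IsLocalMin V x := Eventually.of_forall fun y => by rw [hx]; exact h0 y
    simp [gradient, this.fderiv_eq_zero]
  have hg0 := hgz x0 hx0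
  obtain ⟨P, G, ρ, hρ, hPP, hPs, hPn, hG0, hGC, hGi, hGo, hGF, hdet, hHGP⟩ := chart0 hV hg0
  have hgC := grad_contDiff1 hV
  have hGC0 := hGC 0 (mem_ball_self hρ)
  set g := gradient V with hgdef
  have hPgG : ∀ w ∈ ball (0 : Euc d) ρ, w = P w → P (g (G w)) = g (G w) := by
    intro w hw h
    have := (hGF w hw).2
    rw [← h, sub_self, sub_eq_zero] at this
    exact this.symm
  -- derivative identity
  have hPG' : ∀ w ∈ ball (0 : Euc d) ρ, ∀ v, P (fderiv ℝ G w v) = P v := by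
    intro w hw v
    have h1 : HasFDerivAt (fun w => P (G w - x0)) (P.comp (fderiv ℝ G w)) w := by
      have := ((hGC w hw).differentiableAt (by simp)).hasFDerivAt.sub_const x0
      exact P.hasFDerivAt.comp w this
    have h2 : HasFDerivAt (fun w => P (G w - x0)) P w := by
      apply P.hasFDerivAt.congr_of_eventuallyEq
      filter_upwards [isOpen_ball.mem_nhds hw] with y hy
      exact (hGF y hy).1
    simpa using congrArg (fun B : Euc d →L[ℝ] Euc d => B v) (h1.unique h2)
  -- Lipschitz
  have hgG : ContDiffAt ℝ 1 (fun w => g (G w)) 0 := hgC.contDiffAt.comp 0 hGC0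
  obtain ⟨Kl, tl, htl, hLip⟩ := (hgG.hasStrictFDerivAt one_ne_zero).exists_lipschitzOnWith
  have hm : HasStrictFDerivAt (fun w => g (G (P w))) (0 : Euc d →L[ℝ] Euc d) 0 := by
    have h1 : HasStrictFDerivAt (fun w => g (G w)) ((fderiv ℝ g x0).comp (fderiv ℝ G 0)) (P 0) := by
      rw [map_zero]
      have h2 : HasStrictFDerivAt g (fderiv ℝ g x0) (G 0) := by
        rw [hG0]; exact hgC.contDiffAt.hasStrictFDerivAt one_ne_zero
      exact h2.comp 0 (hGC0.hasStrictFDerivAt one_ne_zero)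
    have h3 := h1.comp (0 : Euc d) P.hasStrictFDerivAt
    have h4 : ((fderiv ℝ g x0).comp (fderiv ℝ G 0)).comp P = 0 := by
      ext1 w; exact hHGP w
    rw [h4] at h3
    exact h3
  set η : NNReal := ⟨min 1 (ν / 4), by positivity⟩ with hη
  have hηpos : (0 : ℝ) < η := by show (0:ℝ) < min 1 (ν / 4); positivity
  have hη1 : (η : ℝ) ≤ 1 := min_le_left _ _
  have hην : (η : ℝ) ≤ ν / 4 := min_le_right _ _
  obtain ⟨tm, htm, hLm⟩ := hm.exists_lipschitzOnWith_of_nnnorm_lt η (by simpa using hηpos)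
  have hGN : ∀ᶠ w in 𝓝 (0 : Euc d), G w ∈ N := by
    have := hGC0.continuousAt.eventually (by rw [hG0]; exact hN.mem_nhds hx0N)
    exact this
  obtain ⟨r1, hr1, hr1b⟩ := Metric.eventually_nhds_iff_ball.1
    (((show ∀ᶠ w in 𝓝 (0 : Euc d), w ∈ tm from htm).and hGN).and (ball_mem_nhds (0 : Euc d) hρ))
  -- V vanishes
  have hzero : ∀ y ∈ ball (0 : Euc d) (r1 / 3), y = P y → V (G y) = 0 := by
    intro y hy hyP
    have hy3 : ‖y‖ < r1 / 3 := by simpa using hy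
    set u := g (G y) with hu
    have hyr : y ∈ ball (0 : Euc d) r1 := by simp; linarith
    have hPu : P u = u := hPgG y (hr1b y hyr).2 hyP
    have hPy := hyP.symm
    have hun : ‖u‖ ≤ η * ‖y‖ := by
      have := hLm.dist_le_mul y (hr1b y hyr).1.1 0 (mem_of_mem_nhds htm)
      simp only [map_zero, hG0, hPy, dist_eq_norm, sub_zero] at this
      have hgx : g x0 = 0 := hg0
      rw [hgx, sub_zero] at this
      exact this
    have hin : ∀ t ∈ Icc (0:ℝ) (1 / η), y - t • u ∈ ball (0 : Euc d) r1 := by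
      intro t ht
      have h1 : ‖t • u‖ ≤ ‖y‖ := by
        rw [norm_smul, Real.norm_of_nonneg ht.1]
        calc t * ‖u‖ ≤ (1 / η) * (η * ‖y‖) := mul_le_mul ht.2 hun (norm_nonneg _) (by positivity)
          _ = ‖y‖ := by field_simp
      have := norm_sub_le y (t • u)
      simp; linarith
    have hPt : ∀ t : ℝ, P (y - t • u) = y - t • u := fun t => by
      rw [map_sub, map_smul, hPu, hPy]
    have hmain := descent_nonneg (h := fun t => V (G (y - t • u)))
      (h' := fun t => - ⟪g (G (y - t • u)), u⟫) (η := η) (G := ‖u‖ ^ 2) hηpos ?_ ?_ (h0 _)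
    · simp only [zero_smul, sub_zero] at hmain
      have hpl := hPL (G y) (hr1b y hyr).1.2
      have h5 : ν * V (G y) ≤ 2 * η * V (G y) := hpl.trans hmain
      have h6 := h0 (G y)
      nlinarith
    · intro t ht
      have hb := (hr1b _ (hin t ht)).2
      have hl : HasDerivAt (fun t : ℝ => y - t • u) (-u) t := by
        have := ((hasDerivAt_id t).smul_const u).const_sub y
        simpa using this
      have hG' := ((hGC _ hb).differentiableAt (by simp)).hasFDerivAt.comp_hasDerivAt t hl
      have hV' := (hV.differentiable (by simp) (G (y - t • u))).hasFDerivAt.comp_hasDerivAt t hG'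
      have heq : (fderiv ℝ V (G (y - t • u))) ((fderiv ℝ G (y - t • u)) (-u)) = - ⟪g (G (y - t • u)), u⟫ := by
        rw [grad_apply]
        have hPg : P (g (G (y - t • u))) = g (G (y - t • u)) := hPgG _ hb (hPt t).symm
        rw [← hgdef]
        generalize g (G (y - t • u)) = k at hPg
        rw [← hPg, hPs, hPG' _ hb, map_neg, hPu, inner_neg_right, hPg]
      rw [heq] at hV'
      exact hV'
    · intro t ht
      have h1 := hLm.dist_le_mul y (hr1b y hyr).1.1 (y - t • u) (hr1b _ (hin t ht)).1.1
      simp only [hPy, hPt, dist_eq_norm, sub_sub_cancel, norm_smul, Real.norm_of_nonneg ht.1] at h1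
      have h2 : - ⟪g (G (y - t • u)), u⟫ = -‖u‖ ^ 2 + ⟪g (G y) - g (G (y - t • u)), u⟫ := by
        rw [inner_sub_left, ← hu, real_inner_self_eq_norm_sq]; ring
      simp only [h2]
      have h3 := real_inner_le_norm (g (G y) - g (G (y - t • u))) u
      have h4 := mul_le_mul_of_nonneg_right h1 (norm_nonneg u)
      nlinarith
  -- final constants
  obtain ⟨L, hL, hLev⟩ := grad_sq_le hV h0 x0 hg0
  have hLG : ∀ᶠ w in 𝓝 (0 : Euc d), ‖g (G w)‖ ^ 2 ≤ L * V (G w) := by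
    have := hGC0.continuousAt.eventually (by rw [hG0]; exact hLev)
    exact this
  have hfc : ContinuousAt (fderiv ℝ G) 0 := (hGC0.fderiv_right (m := 0) (by simp)).continuousAt
  have hdc : ContinuousAt (fun w => |(fderiv ℝ G w).det|) 0 :=
    (ContinuousLinearMap.continuous_det.continuousAt.comp hfc).abs
  have hdpos : 0 < |(fderiv ℝ G 0).det| := abs_pos.2 hdet
  set D := |(fderiv ℝ G 0).det| with hD
  have e1 : ∀ᶠ w in 𝓝 (0 : Euc d), ‖fderiv ℝ G w‖ < ‖fderiv ℝ G 0‖ + 1 :=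
    hfc.norm.eventually (gt_mem_nhds (by linarith))
  have e2 : ∀ᶠ w in 𝓝 (0 : Euc d), |(fderiv ℝ G w).det| < D + 1 :=
    hdc.eventually (gt_mem_nhds (by linarith))
  have e3 : ∀ᶠ w in 𝓝 (0 : Euc d), D / 2 < |(fderiv ℝ G w).det| :=
    hdc.eventually (lt_mem_nhds (by linarith))
  obtain ⟨r2, hr2, hr2b⟩ := Metric.eventually_nhds_iff_ball.1
    ((((e1.and e2).and e3).and (hLG.and hGN)).and ((show ∀ᶠ w in 𝓝 (0 : Euc d), w ∈ tl from htl).and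
      ((show ∀ᶠ w in 𝓝 (0 : Euc d), w ∈ ball (0 : Euc d) ρ from ball_mem_nhds (0 : Euc d) hρ).and
       (ball_mem_nhds (0 : Euc d) (by positivity : 0 < r1 / 3)))))
  have hsub : ball (0 : Euc d) r2 ⊆ ball 0 ρ := fun w hw => (hr2b w hw).2.2.1
  set C := (‖fderiv ℝ G 0‖ + 1) + (D + 1) + 2 / D + L + (Kl : ℝ) ^ 2 / ν with hC
  have c1 : 0 ≤ ‖fderiv ℝ G 0‖ + 1 := by positivity
  have c2 : 0 ≤ 2 / D := by positivity
  have c3 : 0 ≤ (Kl : ℝ) ^ 2 / ν := by positivity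
  refine ⟨P, G, r2, C, hr2, by positivity, hPP, hPn, hG0, ?_, hGi.mono hsub,
    fun O hO => hGo O (hO.trans hsub)⟩
  intro w hw
  obtain ⟨⟨⟨⟨f1, f2⟩, f3⟩, f4, f5⟩, f6, f7, f8⟩ := hr2b w hw
  have hPw : P w ∈ ball (0 : Euc d) r2 := by
    have := hPn w
    simp at hw ⊢; linarith
  obtain ⟨_, k6, k7, k8⟩ := hr2b _ hPw
  have hV0 := h0 (G w)
  refine ⟨hGC w f7, by linarith, by linarith, ?_, ?_, ?_⟩
  · have : 2 / D * (D / 2) ≤ C * |(fderiv ℝ G w).det| := by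
      apply mul_le_mul (by linarith) f3.le (by positivity) (by positivity)
    have h2 : 2 / D * (D / 2) = 1 := by field_simp
    linarith
  · have h1 : ‖w - P w‖ ≤ ‖g (G w)‖ := by
      rw [← (hGF w f7).2]
      set z := g (G w)
      have : ‖z - P z‖ ^ 2 ≤ ‖z‖ ^ 2 := by
        have hz : ⟪z, P z⟫ = ‖P z‖ ^ 2 := by
          rw [← real_inner_self_eq_norm_sq, hPs, hPP]
        rw [norm_sub_sq_real, hz]
        nlinarith [sq_nonneg ‖P z‖]
      exact le_of_sq_le_sq this (norm_nonneg _)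
    calc ‖w - P w‖ ^ 2 ≤ ‖g (G w)‖ ^ 2 := by gcongr
      _ ≤ L * V (G w) := f4
      _ ≤ C * V (G w) := by gcongr; linarith
  · have hz : V (G (P w)) = 0 := hzero _ k8 (hPP w).symm
    have hgz' : g (G (P w)) = 0 := hgz _ hz
    have h1 := hLip.dist_le_mul w f6 (P w) k6
    rw [hgz', dist_zero_right, dist_eq_norm] at h1
    have h2 := hPL (G w) f5
    have h3 : ‖g (G w)‖ ^ 2 ≤ (Kl * ‖w - P w‖) ^ 2 := by gcongr
    have h4 : V (G w) ≤ (Kl : ℝ) ^ 2 / ν * ‖w - P w‖ ^ 2 := by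
      rw [div_mul_eq_mul_div, le_div_iff₀ hν]
      rw [mul_pow] at h3
      linarith
    refine h4.trans ?_
    gcongr
    linarith

lemma seg_sq_le {u : Euc d → ℝ} {K : Set (Euc d)} (hK : Convex ℝ K) (hu : ∀ w ∈ K, ContDiffAt ℝ 1 u w)
    {w w' : Euc d} (hw : w ∈ K) (hw' : w' ∈ K) {Δ : ℝ} (hΔ : ‖w - w'‖ ≤ Δ) :
    ENNReal.ofReal ((u w - u w') ^ 2) ≤ ∫⁻ t in Ioc (0:ℝ) 1,
      ENNReal.ofReal (Δ ^ 2) * ENNReal.ofReal (‖fderiv ℝ u ((1 - t) • w' + t • w)‖ ^ 2) := by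
  set v := w - w' with hv
  let γ : ℝ → Euc d := fun t => (1 - t) • w' + t • w
  have hγ : ∀ t ∈ Icc (0:ℝ) 1, γ t ∈ K := fun t ht =>
    hK hw' hw (by linarith [ht.2]) ht.1 (by ring)
  have hγd : ∀ t, HasDerivAt γ v t := by
    intro t
    have h1 : HasDerivAt (fun t : ℝ => (1 - t) • w') ((-1 : ℝ) • w') t :=
      ((hasDerivAt_id t).const_sub 1).smul_const w'
    have h2 : HasDerivAt (fun t : ℝ => t • w) ((1:ℝ) • w) t := (hasDerivAt_id t).smul_const w
    have h3 := h1.add h2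
    have h4 : (-1 : ℝ) • w' + (1:ℝ) • w = v := by rw [hv]; module
    rw [h4] at h3
    exact h3
  have hγc : Continuous γ := by fun_prop
  let φ : ℝ → ℝ := fun t => fderiv ℝ u (γ t) v
  have hφ : ∀ t ∈ Icc (0:ℝ) 1, HasDerivAt (fun t => u (γ t)) (φ t) t := fun t ht =>
    (((hu _ (hγ t ht)).differentiableAt (by simp)).hasFDerivAt).comp_hasDerivAt t (hγd t)
  have hfc : ContinuousOn (fun t => fderiv ℝ u (γ t)) (Icc 0 1) := by
    intro t ht
    have h1 : ContinuousAt (fderiv ℝ u) (γ t) := ((hu _ (hγ t ht)).fderiv_right (m := 0) (by simp)).continuousAt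
    exact (ContinuousAt.comp (f := γ) h1 hγc.continuousAt).continuousWithinAt
  have hφc : ContinuousOn φ (Icc 0 1) := hfc.clm_apply continuousOn_const
  have hI : ∀ {ψ : ℝ → ℝ}, ContinuousOn ψ (Icc 0 1) → IntegrableOn ψ (Ioc 0 1) := fun h =>
    (h.integrableOn_compact isCompact_Icc).mono_set Ioc_subset_Icc_self
  have hftc : ∫ t in Ioc (0:ℝ) 1, φ t = u w - u w' := by
    rw [← intervalIntegral.integral_of_le zero_le_one]
    rw [intervalIntegral.integral_eq_sub_of_hasDerivAt (f := fun t => u (γ t))]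
    · simp [γ]
    · rw [uIcc_of_le zero_le_one]; exact hφ
    · apply ContinuousOn.intervalIntegrable; rw [uIcc_of_le zero_le_one]; exact hφc
  set m := u w - u w' with hm
  have h1 : m ^ 2 ≤ ∫ t in Ioc (0:ℝ) 1, φ t ^ 2 := by
    have h2 : ∫ t in Ioc (0:ℝ) 1, (2 * m * φ t - m ^ 2) = m ^ 2 := by
      have hc : IntegrableOn (fun _ : ℝ => m ^ 2) (Ioc (0:ℝ) 1) := hI continuousOn_const
      rw [integral_sub ((hI hφc).const_mul _) hc, integral_const_mul, hftc]
      simp; ring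
    rw [← h2]
    apply integral_mono
    · exact ((hI hφc).const_mul _).sub (hI continuousOn_const)
    · exact hI (hφc.pow 2)
    · intro t; simp only; nlinarith [sq_nonneg (φ t - m)]
  have h2 : ∫ t in Ioc (0:ℝ) 1, φ t ^ 2 ≤ ∫ t in Ioc (0:ℝ) 1, Δ ^ 2 * ‖fderiv ℝ u (γ t)‖ ^ 2 := by
    apply integral_mono (hI (hφc.pow 2)) (hI (continuousOn_const.mul (hfc.norm.pow 2)))
    intro t
    show φ t ^ 2 ≤ Δ ^ 2 * ‖fderiv ℝ u (γ t)‖ ^ 2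
    have h3 := (fderiv ℝ u (γ t)).le_opNorm v
    have h4 : |φ t| ≤ ‖fderiv ℝ u (γ t)‖ * Δ := h3.trans (by gcongr)
    rw [← sq_abs, ← mul_pow, mul_comm Δ]
    exact pow_le_pow_left₀ (abs_nonneg _) h4 2
  calc ENNReal.ofReal (m ^ 2) ≤ ENNReal.ofReal (∫ t in Ioc (0:ℝ) 1, Δ ^ 2 * ‖fderiv ℝ u (γ t)‖ ^ 2) :=
        ENNReal.ofReal_le_ofReal (h1.trans h2)
    _ = ∫⁻ t in Ioc (0:ℝ) 1, ENNReal.ofReal (Δ ^ 2 * ‖fderiv ℝ u (γ t)‖ ^ 2) := by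
        apply ofReal_integral_eq_lintegral_ofReal
        · exact hI (continuousOn_const.mul (hfc.norm.pow 2))
        · exact Eventually.of_forall fun t => by positivity
    _ = _ := by
        apply lintegral_congr; intro t
        rw [ENNReal.ofReal_mul (by positivity)]

lemma lint_scale {h : Euc d → ℝ≥0∞} (hh : Measurable h) {t : ℝ} (ht : 1 / 2 ≤ t) (z : Euc d) :
    ∫⁻ w, h (z + t • w) ≤ 2 ^ d * ∫⁻ w, h w := by
  have ht0 : 0 < t := by linarith
  have h1 : ∫⁻ w, h (z + t • w) = ∫⁻ y, h (z + y) ∂(Measure.map (fun x : Euc d => t • x) volume) := by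
    rw [lintegral_map (by fun_prop) (by fun_prop)]
  rw [h1, Measure.map_addHaar_smul _ ht0.ne', lintegral_smul_measure, lintegral_add_left_eq_self]
  rw [smul_eq_mul]
  gcongr
  rw [finrank_euclideanSpace, Fintype.card_fin, abs_of_pos (by positivity), ← inv_pow]
  have : t⁻¹ ≤ 2 := by rw [inv_le_comm₀ ht0 two_pos]; linarith
  calc ENNReal.ofReal (t⁻¹ ^ d) ≤ ENNReal.ofReal (2 ^ d) := by gcongr
    _ = 2 ^ d := by rw [ENNReal.ofReal_pow (by norm_num)]; simp

lemma convex_poincare {u : Euc d → ℝ} {K : Set (Euc d)} (hK : Convex ℝ K) (hKm : MeasurableSet K)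
    (hu : ∀ w ∈ K, ContDiffAt ℝ 1 u w) {Δ : ℝ} (hΔ : ∀ w ∈ K, ∀ w' ∈ K, ‖w - w'‖ ≤ Δ) :
    ∫⁻ w in K, ∫⁻ w' in K, ENNReal.ofReal ((u w - u w') ^ 2) ≤
      ENNReal.ofReal (Δ ^ 2) * 2 ^ d * (volume K * ∫⁻ w in K, ENNReal.ofReal (‖fderiv ℝ u w‖ ^ 2)) := by
  let h : Euc d → ℝ≥0∞ := K.indicator (fun w => ENNReal.ofReal (‖fderiv ℝ u w‖ ^ 2))
  have hm : Measurable h := by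
    apply Measurable.indicator _ hKm
    exact ((measurable_fderiv ℝ u).norm.pow_const 2).ennreal_ofReal
  have hint : ∫⁻ w, h w = ∫⁻ w in K, ENNReal.ofReal (‖fderiv ℝ u w‖ ^ 2) := lintegral_indicator hKm _
  have step1 : ∫⁻ w in K, ∫⁻ w' in K, ENNReal.ofReal ((u w - u w') ^ 2) ≤
      ∫⁻ w in K, ∫⁻ w' in K, ∫⁻ t in Ioc (0:ℝ) 1, ENNReal.ofReal (Δ ^ 2) * h ((1 - t) • w' + t • w) := by
    apply setLIntegral_mono' hKm
    intro w hw
    apply setLIntegral_mono' hKm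
    intro w' hw'
    refine (seg_sq_le hK hu hw hw' (hΔ w hw w' hw')).trans ?_
    apply setLIntegral_mono' measurableSet_Ioc
    intro t ht
    have : (1 - t) • w' + t • w ∈ K := hK hw' hw (by linarith [ht.2]) ht.1.le (by ring)
    simp only [h, indicator_of_mem this]
    exact le_rfl
  refine step1.trans ?_
  have hmeas : ∀ w, Measurable (Function.uncurry fun (w' : Euc d) (t : ℝ) => ENNReal.ofReal (Δ ^ 2) * h ((1 - t) • w' + t • w)) := by
    intro w
    apply Measurable.const_mul
    apply hm.comp
    fun_prop
  have hmeas2 : Measurable (fun p : (Euc d × ℝ) × Euc d => ENNReal.ofReal (Δ ^ 2) * h ((1 - p.1.2) • p.2 + p.1.2 • p.1.1)) := by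
    apply Measurable.const_mul
    apply hm.comp
    fun_prop
  have step2 : ∫⁻ w in K, ∫⁻ w' in K, ∫⁻ t in Ioc (0:ℝ) 1, ENNReal.ofReal (Δ ^ 2) * h ((1 - t) • w' + t • w) =
      ∫⁻ t in Ioc (0:ℝ) 1, ∫⁻ w in K, ∫⁻ w' in K, ENNReal.ofReal (Δ ^ 2) * h ((1 - t) • w' + t • w) := by
    have hsw : ∫⁻ w in K, ∫⁻ w' in K, ∫⁻ t in Ioc (0:ℝ) 1, ENNReal.ofReal (Δ ^ 2) * h ((1 - t) • w' + t • w) =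
        ∫⁻ w in K, ∫⁻ t in Ioc (0:ℝ) 1, ∫⁻ w' in K, ENNReal.ofReal (Δ ^ 2) * h ((1 - t) • w' + t • w) := by
      apply lintegral_congr; intro w
      rw [lintegral_lintegral_swap (hmeas w).aemeasurable]
    rw [hsw]
    apply lintegral_lintegral_swap
    apply Measurable.aemeasurable
    exact hmeas2.lintegral_prod_right'
  rw [step2]
  have step3 : ∀ t ∈ Ioc (0:ℝ) 1, ∫⁻ w in K, ∫⁻ w' in K, ENNReal.ofReal (Δ ^ 2) * h ((1 - t) • w' + t • w) ≤
      ENNReal.ofReal (Δ ^ 2) * 2 ^ d * (volume K * ∫⁻ w, h w) := by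
    intro t ht
    by_cases h2 : 1 / 2 ≤ t
    · rw [lintegral_lintegral_swap]
      · calc _ ≤ ∫⁻ w' in K, ENNReal.ofReal (Δ ^ 2) * (2 ^ d * ∫⁻ w, h w) := by
              apply lintegral_mono; intro w'
              simp only
              rw [lintegral_const_mul _ (by apply hm.comp; fun_prop)]
              gcongr
              exact (setLIntegral_le_lintegral _ _).trans (lint_scale hm h2 _)
          _ = _ := by
              rw [setLIntegral_const]; ring
      · apply Measurable.aemeasurable
        apply Measurable.const_mul
        apply hm.comp
        fun_prop
    · calc _ ≤ ∫⁻ w in K, ENNReal.ofReal (Δ ^ 2) * (2 ^ d * ∫⁻ w, h w) := by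
              apply lintegral_mono; intro w
              simp only
              rw [lintegral_const_mul _ (by apply hm.comp; fun_prop)]
              gcongr
              refine (setLIntegral_le_lintegral _ _).trans ?_
              simp_rw [add_comm _ (t • w)]
              exact lint_scale hm (by linarith) _
          _ = _ := by
              rw [setLIntegral_const]; ring
  calc _ ≤ ∫⁻ t in Ioc (0:ℝ) 1, ENNReal.ofReal (Δ ^ 2) * 2 ^ d * (volume K * ∫⁻ w, h w) :=
        setLIntegral_mono' measurableSet_Ioc step3
    _ = _ := by rw [setLIntegral_const, hint]; simp

def Tube (P : Euc d →L[ℝ] Euc d) (r s : ℝ) : Set (Euc d) := {w | ‖P w‖ < r ∧ ‖w - P w‖ ≤ s}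

def DirE (V f : Euc d → ℝ) (ε : ℝ) : ℝ≥0∞ := ∫⁻ x, ENNReal.ofReal (‖gradient f x‖ ^ 2 * exp (-V x / ε))

def GoodSet (V : Euc d → ℝ) (a : ℝ) (O : Set (Euc d)) : Prop :=
  ∃ C : ℝ≥0∞, C ≠ ∞ ∧ ∃ ε₁ > (0:ℝ), ∀ ε : ℝ, 0 < ε → ε ≤ ε₁ → ∀ f : Euc d → ℝ, ContDiff ℝ 1 f →
    ∫⁻ p in O ∩ {x | V x ≤ a * ε}, ∫⁻ q in O ∩ {x | V x ≤ a * ε}, ENNReal.ofReal ((f p - f q) ^ 2) ≤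
      C * (volume (O ∩ {x | V x ≤ a * ε}) * DirE V f ε)

def DblSet (V : Euc d → ℝ) (a : ℝ) (O : Set (Euc d)) : Prop :=
  ∀ y ∈ O, V y = 0 → ∀ N ∈ 𝓝 y, ∃ C : ℝ≥0∞, C ≠ ∞ ∧ ∃ ε₁ > (0:ℝ), ∀ ε : ℝ, 0 < ε → ε ≤ ε₁ →
    volume (O ∩ {x | V x ≤ a * ε}) ≤ C * volume (N ∩ {x | V x ≤ a * ε})

lemma tube_convex (P : Euc d →L[ℝ] Euc d) (r s : ℝ) : Convex ℝ (Tube P r s) := by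
  have h1 : Tube P r s = P ⁻¹' (ball 0 r) ∩ (ContinuousLinearMap.id ℝ (Euc d) - P) ⁻¹' (closedBall 0 s) := by
    ext w; simp [Tube]
  rw [h1]
  exact ((convex_ball _ _).is_linear_preimage P.toLinearMap.isLinear).inter
    ((convex_closedBall _ _).is_linear_preimage (ContinuousLinearMap.id ℝ (Euc d) - P).toLinearMap.isLinear)

lemma tube_meas (P : Euc d →L[ℝ] Euc d) (r s : ℝ) : MeasurableSet (Tube P r s) := by
  have h1 : IsOpen {w : Euc d | ‖P w‖ < r} := isOpen_lt (by fun_prop) (by fun_prop)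
  have h2 : IsClosed {w : Euc d | ‖w - P w‖ ≤ s} := isClosed_le (by fun_prop) (by fun_prop)
  exact h1.measurableSet.inter h2.measurableSet

lemma tube_vol {P : Euc d →L[ℝ] Euc d} (hPP : ∀ w, P (P w) = P w) {r1 r2 m1 m2 : ℝ} (hr1 : 0 < r1)
    (hr2 : 0 < r2) (hm1 : 0 < m1) (hm2 : 0 < m2) : ∃ κ : ℝ≥0∞, κ ≠ ∞ ∧ ∀ s : ℝ, 0 < s →
      volume (Tube P r1 (m1 * s)) ≤ κ * volume (Tube P r2 (m2 * s)) := by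
  let A : Euc d →L[ℝ] Euc d := (r1 / r2) • P + (m1 / m2) • (ContinuousLinearMap.id ℝ (Euc d) - P)
  refine ⟨ENNReal.ofReal |LinearMap.det (A : Euc d →ₗ[ℝ] Euc d)|, ENNReal.ofReal_ne_top, fun s hs => ?_⟩
  rw [← Measure.addHaar_image_linearMap]
  apply measure_mono
  intro w hw
  obtain ⟨h1, h2⟩ := hw
  have hP : P ((r2 / r1) • P w + (m2 / m1) • (w - P w)) = (r2 / r1) • P w := by
    simp [hPP]
  refine ⟨(r2 / r1) • P w + (m2 / m1) • (w - P w), ⟨?_, ?_⟩, ?_⟩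
  · rw [hP, norm_smul, Real.norm_of_nonneg (by positivity)]
    rw [div_mul_eq_mul_div, div_lt_iff₀ hr1]
    nlinarith
  · rw [hP, add_sub_cancel_left, norm_smul, Real.norm_of_nonneg (by positivity)]
    rw [div_mul_eq_mul_div, div_le_iff₀ hm1]
    nlinarith
  · show (r1 / r2) • P ((r2 / r1) • P w + (m2 / m1) • (w - P w)) + (m1 / m2) •
      (((r2 / r1) • P w + (m2 / m1) • (w - P w)) - P ((r2 / r1) • P w + (m2 / m1) • (w - P w))) = w
    rw [hP, add_sub_cancel_left, smul_smul, smul_smul]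
    have e1 : r1 / r2 * (r2 / r1) = 1 := by field_simp
    have e2 : m1 / m2 * (m2 / m1) = 1 := by field_simp
    rw [e1, e2]; simp

lemma cov_le {G : Euc d → Euc d} {B T : Set (Euc d)} {C : ℝ} (hC : 0 < C)
    (hG : ∀ w ∈ B, ContDiffAt ℝ 1 G w ∧ |(fderiv ℝ G w).det| ≤ C ∧ 1 ≤ C * |(fderiv ℝ G w).det|)
    (hi : InjOn G B) (hTB : T ⊆ B) (hT : MeasurableSet T) (h : Euc d → ℝ≥0∞) :
    ∫⁻ x in G '' T, h x ≤ ENNReal.ofReal C * ∫⁻ w in T, h (G w) ∧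
    ∫⁻ w in T, h (G w) ≤ ENNReal.ofReal C * ∫⁻ x in G '' T, h x := by
  have := lintegral_image_eq_lintegral_abs_det_fderiv_mul volume hT (f := G) (f' := fderiv ℝ G)
    (fun w hw => ((hG w (hTB hw)).1.differentiableAt (by simp)).hasFDerivAt.hasFDerivWithinAt) (hi.mono hTB) h
  rw [this]
  constructor
  · rw [← lintegral_const_mul' _ _ ENNReal.ofReal_ne_top]
    apply setLIntegral_mono' hT
    intro w hw
    gcongr
    exact (hG w (hTB hw)).2.1
  · rw [← lintegral_const_mul' _ _ ENNReal.ofReal_ne_top]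
    apply setLIntegral_mono' hT
    intro w hw
    rw [← mul_assoc, ← ENNReal.ofReal_mul hC.le]
    have := ENNReal.ofReal_le_ofReal (hG w (hTB hw)).2.2
    rw [ENNReal.ofReal_one] at this
    calc h (G w) = 1 * h (G w) := (one_mul _).symm
      _ ≤ _ := by gcongr

lemma cov_vol {G : Euc d → Euc d} {B T : Set (Euc d)} {C : ℝ} (hC : 0 < C)
    (hG : ∀ w ∈ B, ContDiffAt ℝ 1 G w ∧ |(fderiv ℝ G w).det| ≤ C ∧ 1 ≤ C * |(fderiv ℝ G w).det|)
    (hi : InjOn G B) (hTB : T ⊆ B) (hT : MeasurableSet T) :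
    volume (G '' T) ≤ ENNReal.ofReal C * volume T ∧ volume T ≤ ENNReal.ofReal C * volume (G '' T) := by
  simpa using cov_le hC hG hi hTB hT (fun _ => 1)

lemma local_good {V : Euc d → ℝ} (hV : ContDiff ℝ 2 V) (h0 : ∀ x, 0 ≤ V x) {ν : ℝ} (hν : 0 < ν)
    {N : Set (Euc d)} (hN : IsOpen N) (hPL : ∀ x ∈ N, ν * V x ≤ ‖gradient V x‖ ^ 2)
    {x0 : Euc d} (hx0N : x0 ∈ N) (hx0 : V x0 = 0) {a : ℝ} (ha : 0 < a) :
    ∃ O, IsOpen O ∧ x0 ∈ O ∧ GoodSet V a O ∧ DblSet V a O := by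
  obtain ⟨P, G, ρ, C, hρ, hC, hPP, hPn, hG0, hG, hGi, hGo⟩ := chart1 hV h0 hν hN hPL hx0N hx0
  have hG' : ∀ w ∈ ball (0 : Euc d) ρ, ContDiffAt ℝ 1 G w ∧ |(fderiv ℝ G w).det| ≤ C ∧ 1 ≤ C * |(fderiv ℝ G w).det| :=
    fun w hw => ⟨(hG w hw).1, (hG w hw).2.2.1, (hG w hw).2.2.2.1⟩
  set r := ρ / 3 with hr
  have hr0 : 0 < r := by positivity
  let Br : Set (Euc d) := {w | ‖P w‖ < r ∧ ‖w - P w‖ < r}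
  have hBro1 : IsOpen {w : Euc d | ‖P w‖ < r} := isOpen_lt (by fun_prop) (by fun_prop)
  have hBro2 : IsOpen {w : Euc d | ‖w - P w‖ < r} := isOpen_lt (by fun_prop) (by fun_prop)
  have hBro : IsOpen Br := hBro1.inter hBro2
  have hBrB : Br ⊆ ball (0 : Euc d) ρ := by
    intro w hw
    have h1 : ‖w‖ ≤ ‖P w‖ + ‖w - P w‖ := by simpa using norm_add_le (P w) (w - P w)
    have h2 := hw.1
    have h3 := hw.2
    simp only [mem_ball, dist_zero_right]
    linarith
  set W := G '' Br with hW
  have hWo : IsOpen W := hGo Br hBrB hBro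
  have hx0W : x0 ∈ W := ⟨0, ⟨by simpa using hr0, by simpa using hr0⟩, hG0⟩
  set M := √(C * a) with hM
  have hM0 : 0 < M := by positivity
  set m := √(a / C) with hm
  have hm0 : 0 < m := by positivity
  have hTB : ∀ s, s < r → Tube P r s ⊆ Br := fun s hs w hw => ⟨hw.1, hw.2.trans_lt hs⟩
  -- W ∩ U ⊆ G '' tube
  have hsub : ∀ ε : ℝ, 0 < ε → W ∩ {x | V x ≤ a * ε} ⊆ G '' Tube P r (M * √ε) := by
    rintro ε hε _ ⟨⟨w, hw, rfl⟩, hwU⟩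
    refine ⟨w, ⟨hw.1, ?_⟩, rfl⟩
    have h1 := (hG w (hBrB hw)).2.2.2.2.1
    have hwU' : V (G w) ≤ a * ε := hwU
    rw [hM, ← Real.sqrt_mul (by positivity)]
    apply Real.le_sqrt_of_sq_le
    nlinarith
  have key : ∀ y ∈ W, V y = 0 → ∀ N' ∈ 𝓝 y, ∃ c : ℝ≥0∞, c ≠ ∞ ∧ ∃ ε₁ > (0:ℝ), ∀ ε : ℝ, 0 < ε → ε ≤ ε₁ →
      volume (Tube P r (M * √ε)) ≤ c * volume (N' ∩ {x | V x ≤ a * ε}) := by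
    rintro _ ⟨w0, hw0, rfl⟩ hy N' hN'
    have hQ0 : w0 - P w0 = 0 := by
      have := (hG w0 (hBrB hw0)).2.2.2.2.1
      rw [hy, mul_zero] at this
      have h2 : ‖w0 - P w0‖ ^ 2 = 0 := le_antisymm this (by positivity)
      simpa using h2
    have hev : ∀ᶠ w in 𝓝 w0, G w ∈ N' ∧ w ∈ ball (0 : Euc d) ρ :=
      ((hG w0 (hBrB hw0)).1.continuousAt.eventually hN').and (isOpen_ball.mem_nhds (hBrB hw0))
    obtain ⟨δ, hδ, hδb⟩ := Metric.eventually_nhds_iff_ball.1 hev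
    obtain ⟨κ, hκ, hκv⟩ := tube_vol hPP hr0 (half_pos hδ) hM0 hm0
    refine ⟨κ * ENNReal.ofReal C, ENNReal.mul_ne_top hκ ENNReal.ofReal_ne_top, (δ / (4 * m)) ^ 2, by positivity, fun ε hε hεle => ?_⟩
    have hs : √ε ≤ δ / (4 * m) := by
      rw [Real.sqrt_le_left (by positivity)]; exact hεle
    have hms : m * √ε ≤ δ / 4 := by
      rw [le_div_iff₀ (by positivity)] at hs
      linarith
    let T' : Set (Euc d) := (fun w => w0 + w) '' Tube P (δ / 2) (m * √ε)
    have hT'b : T' ⊆ ball w0 δ := by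
      rintro _ ⟨w, hw, rfl⟩
      have h1 : ‖w‖ ≤ ‖P w‖ + ‖w - P w‖ := by simpa using norm_add_le (P w) (w - P w)
      have h2 := hw.1
      have h3 := hw.2
      simp only [mem_ball, dist_self_add_left]
      linarith
    have hT'B : T' ⊆ ball (0 : Euc d) ρ := fun w hw => (hδb w (hT'b hw)).2
    have hT'm : MeasurableSet T' := by
      have := (Homeomorph.addLeft w0).measurableEmbedding.measurableSet_image' (tube_meas P (δ / 2) (m * √ε))
      exact this
    have hT'v : volume T' = volume (Tube P (δ / 2) (m * √ε)) := by
      simp only [T', image_add_left]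
      exact measure_preimage_add volume (-w0) _
    have hT'N : G '' T' ⊆ N' ∩ {x | V x ≤ a * ε} := by
      rintro _ ⟨_, ⟨w, hw, rfl⟩, rfl⟩
      have hin : w0 + w ∈ T' := ⟨w, hw, rfl⟩
      refine ⟨(hδb _ (hT'b hin)).1, ?_⟩
      have h1 := (hG _ (hT'B hin)).2.2.2.2.2
      have h2 : w0 + w - P (w0 + w) = w - P w := by
        rw [map_add]
        calc w0 + w - (P w0 + P w) = (w0 - P w0) + (w - P w) := by abel
          _ = w - P w := by rw [hQ0, zero_add]
      simp only [h2] at h1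
      have h3 : ‖w - P w‖ ^ 2 ≤ (m * √ε) ^ 2 := by have := hw.2; gcongr
      have h4 : (m * √ε) ^ 2 = a / C * ε := by
        rw [mul_pow, hm, Real.sq_sqrt (by positivity), Real.sq_sqrt hε.le]
      rw [h4] at h3
      show V (G (w0 + w)) ≤ a * ε
      calc V (G (w0 + w)) ≤ C * ‖w - P w‖ ^ 2 := h1
        _ ≤ C * (a / C * ε) := by gcongr
        _ = a * ε := by field_simp
    calc volume (Tube P r (M * √ε)) ≤ κ * volume (Tube P (δ / 2) (m * √ε)) := hκv _ (by positivity)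
      _ = κ * volume T' := by rw [hT'v]
      _ ≤ κ * (ENNReal.ofReal C * volume (G '' T')) := by
          gcongr; exact (cov_vol hC hG' hGi hT'B hT'm).2
      _ ≤ κ * (ENNReal.ofReal C * volume (N' ∩ {x | V x ≤ a * ε})) := by gcongr
      _ = _ := by ring
  have hMs : ∀ ε : ℝ, ε ≤ (r / (2 * M)) ^ 2 → M * √ε < r := by
    intro ε hε
    have hs : √ε ≤ r / (2 * M) := by
      rw [Real.sqrt_le_left (by positivity)]; exact hε
    rw [le_div_iff₀ (by positivity)] at hs
    linarith
  have hupper : ∀ ε : ℝ, 0 < ε → ε ≤ (r / (2 * M)) ^ 2 →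
      volume (W ∩ {x | V x ≤ a * ε}) ≤ ENNReal.ofReal C * volume (Tube P r (M * √ε)) := by
    intro ε hε hεle
    exact (measure_mono (hsub ε hε)).trans
      (cov_vol hC hG' hGi ((hTB _ (hMs ε hεle)).trans hBrB) (tube_meas _ _ _)).1
  refine ⟨W, hWo, hx0W, ?_, ?_⟩
  · obtain ⟨c, hc, ε₁, hε₁, hcv⟩ := key x0 hx0W hx0 W (hWo.mem_nhds hx0W)
    refine ⟨ENNReal.ofReal C * ENNReal.ofReal C * (ENNReal.ofReal ((2 * ρ) ^ 2) * 2 ^ d) * c *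
      (ENNReal.ofReal (C ^ 2) * ENNReal.ofReal C * ENNReal.ofReal (exp (C * M ^ 2))), ?_,
      min ε₁ ((r / (2 * M)) ^ 2), by positivity, fun ε hε hεle f hf => ?_⟩
    · have h2 : (2 : ℝ≥0∞) ^ d ≠ ∞ := by simp
      exact ENNReal.mul_ne_top (ENNReal.mul_ne_top (ENNReal.mul_ne_top (by simp [ENNReal.mul_eq_top]) (ENNReal.mul_ne_top (by simp) h2)) hc)
        (by simp [ENNReal.mul_eq_top])
    set T := Tube P r (M * √ε) with hT
    have hTr := hMs ε (hεle.trans (min_le_right _ _))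
    have hTBall : T ⊆ ball (0 : Euc d) ρ := (hTB _ hTr).trans hBrB
    have hTm : MeasurableSet T := tube_meas _ _ _
    set A := W ∩ {x | V x ≤ a * ε} with hA
    have hTA : volume T ≤ c * volume A := hcv ε hε (hεle.trans (min_le_left _ _))
    have s1 : ∫⁻ p in A, ∫⁻ q in A, ENNReal.ofReal ((f p - f q) ^ 2) ≤
        ENNReal.ofReal C * (ENNReal.ofReal C * ∫⁻ w in T, ∫⁻ w' in T, ENNReal.ofReal ((f (G w) - f (G w')) ^ 2)) := by
      calc ∫⁻ p in A, ∫⁻ q in A, ENNReal.ofReal ((f p - f q) ^ 2)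
          ≤ ∫⁻ p in A, ENNReal.ofReal C * ∫⁻ w' in T, ENNReal.ofReal ((f p - f (G w')) ^ 2) := by
            apply lintegral_mono; intro p
            exact (lintegral_mono_set (hsub ε hε)).trans (cov_le hC hG' hGi hTBall hTm _).1
        _ ≤ ∫⁻ p in G '' T, ENNReal.ofReal C * ∫⁻ w' in T, ENNReal.ofReal ((f p - f (G w')) ^ 2) :=
            lintegral_mono_set (hsub ε hε)
        _ ≤ ENNReal.ofReal C * ∫⁻ w in T, ENNReal.ofReal C * ∫⁻ w' in T, ENNReal.ofReal ((f (G w) - f (G w')) ^ 2) :=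
            (cov_le hC hG' hGi hTBall hTm _).1
        _ = _ := by rw [lintegral_const_mul' _ _ ENNReal.ofReal_ne_top]
    have s2 := convex_poincare (u := fun w => f (G w)) (tube_convex P r (M * √ε)) hTm
      (fun w hw => hf.contDiffAt.comp w (hG w (hTBall hw)).1) (Δ := 2 * ρ) (by
        intro w hw w' hw'
        have h1 := hTBall hw
        have h2 := hTBall hw'
        simp only [mem_ball, dist_zero_right] at h1 h2
        have := norm_sub_le w w'
        linarith)
    have s3 : ∫⁻ w in T, ENNReal.ofReal (‖fderiv ℝ (fun w => f (G w)) w‖ ^ 2) ≤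
        ENNReal.ofReal (C ^ 2) * ∫⁻ w in T, ENNReal.ofReal (‖gradient f (G w)‖ ^ 2) := by
      rw [← lintegral_const_mul' _ _ ENNReal.ofReal_ne_top]
      apply setLIntegral_mono' hTm
      intro w hw
      have hw' := hTBall hw
      have h1 : fderiv ℝ (fun w => f (G w)) w = (fderiv ℝ f (G w)).comp (fderiv ℝ G w) :=
        fderiv_comp w (hf.differentiable (by simp) _) ((hG w hw').1.differentiableAt (by simp))
      rw [h1, ← ENNReal.ofReal_mul (by positivity), norm_grad, ← mul_pow]
      apply ENNReal.ofReal_le_ofReal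
      have h2 := ContinuousLinearMap.opNorm_comp_le (fderiv ℝ f (G w)) (fderiv ℝ G w)
      have h3 := (hG w hw').2.1
      have h4 : ‖(fderiv ℝ f (G w)).comp (fderiv ℝ G w)‖ ≤ C * ‖fderiv ℝ f (G w)‖ := by
        rw [mul_comm]; exact h2.trans (by gcongr)
      gcongr
    have s4 : ∫⁻ w in T, ENNReal.ofReal (‖gradient f (G w)‖ ^ 2) ≤
        ENNReal.ofReal C * (ENNReal.ofReal (exp (C * M ^ 2)) * DirE V f ε) := by
      calc ∫⁻ w in T, ENNReal.ofReal (‖gradient f (G w)‖ ^ 2)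
          ≤ ∫⁻ w in T, ENNReal.ofReal (exp (C * M ^ 2)) * ENNReal.ofReal (‖gradient f (G w)‖ ^ 2 * exp (-V (G w) / ε)) := by
            apply setLIntegral_mono' hTm
            intro w hw
            rw [← ENNReal.ofReal_mul (by positivity)]
            apply ENNReal.ofReal_le_ofReal
            have h1 := (hG w (hTBall hw)).2.2.2.2.2
            have h2 : ‖w - P w‖ ^ 2 ≤ (M * √ε) ^ 2 := by have := hw.2; gcongr
            rw [mul_pow, Real.sq_sqrt hε.le] at h2
            have h3 : V (G w) ≤ C * M ^ 2 * ε := by nlinarith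
            have h4 : 0 ≤ C * M ^ 2 + -V (G w) / ε := by
              rw [neg_div]
              have : V (G w) / ε ≤ C * M ^ 2 := by rw [div_le_iff₀ hε]; exact h3
              linarith
            have h5 : 1 ≤ exp (C * M ^ 2) * exp (-V (G w) / ε) := by
              rw [← Real.exp_add]; exact Real.one_le_exp h4
            nlinarith [sq_nonneg ‖gradient f (G w)‖]
        _ ≤ ENNReal.ofReal C * ∫⁻ x in G '' T, ENNReal.ofReal (exp (C * M ^ 2)) * ENNReal.ofReal (‖gradient f x‖ ^ 2 * exp (-V x / ε)) :=
            (cov_le hC hG' hGi hTBall hTm _).2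
        _ ≤ ENNReal.ofReal C * ∫⁻ x, ENNReal.ofReal (exp (C * M ^ 2)) * ENNReal.ofReal (‖gradient f x‖ ^ 2 * exp (-V x / ε)) := by
            exact mul_le_mul_right (setLIntegral_le_lintegral _ _) _
        _ = _ := by rw [lintegral_const_mul' _ _ ENNReal.ofReal_ne_top]; rfl
    calc ∫⁻ p in A, ∫⁻ q in A, ENNReal.ofReal ((f p - f q) ^ 2)
        ≤ ENNReal.ofReal C * (ENNReal.ofReal C * (ENNReal.ofReal ((2 * ρ) ^ 2) * 2 ^ d * ((c * volume A) *
          (ENNReal.ofReal (C ^ 2) * (ENNReal.ofReal C * (ENNReal.ofReal (exp (C * M ^ 2)) * DirE V f ε)))))) := by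
          refine s1.trans ?_
          gcongr
          refine s2.trans ?_
          gcongr
          refine s3.trans ?_
          gcongr
      _ = _ := by ring
  · intro y hy hy0 N' hN'
    obtain ⟨c, hc, ε₁, hε₁, hcv⟩ := key y hy hy0 N' hN'
    refine ⟨ENNReal.ofReal C * c, ENNReal.mul_ne_top ENNReal.ofReal_ne_top hc,
      min ε₁ ((r / (2 * M)) ^ 2), by positivity, fun ε hε hεle => ?_⟩
    calc _ ≤ _ := hupper ε hε (hεle.trans (min_le_right _ _))
      _ ≤ ENNReal.ofReal C * (c * volume (N' ∩ {x | V x ≤ a * ε})) := by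
        gcongr; exact hcv ε hε (hεle.trans (min_le_left _ _))
      _ = _ := by ring

lemma cross_le {f : Euc d → ℝ} (hf : Continuous f) {A B I : Set (Euc d)} (hIA : I ⊆ A) (hIB : I ⊆ B)
    (hAf : volume A ≠ ∞) (hBf : volume B ≠ ∞) :
    volume I * ∫⁻ p in A, ∫⁻ q in B, ENNReal.ofReal ((f p - f q) ^ 2) ≤
      2 * (volume B * (∫⁻ p in A, ∫⁻ q in A, ENNReal.ofReal ((f p - f q) ^ 2)) +
        volume A * ∫⁻ p in B, ∫⁻ q in B, ENNReal.ofReal ((f p - f q) ^ 2)) := by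
  have hIf : volume I ≠ ∞ := ne_top_of_le_ne_top hAf (measure_mono hIA)
  have hmeas : Measurable (fun p : Euc d × Euc d => ENNReal.ofReal ((f p.1 - f p.2) ^ 2)) := by
    have : Continuous (fun p : Euc d × Euc d => (f p.1 - f p.2) ^ 2) := by fun_prop
    exact this.measurable.ennreal_ofReal
  let b : Euc d → ℝ≥0∞ := fun p => ∫⁻ w in I, ENNReal.ofReal ((f p - f w) ^ 2)
  have hb : Measurable b := hmeas.lintegral_prod_right'
  have h1 : ∀ p q, volume I * ENNReal.ofReal ((f p - f q) ^ 2) ≤ 2 * b p + 2 * b q := by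
    intro p q
    rw [mul_comm, ← setLIntegral_const]
    simp only [b]
    rw [← lintegral_const_mul' _ _ (by simp), ← lintegral_const_mul' _ _ (by simp), ← lintegral_add_left]
    · apply lintegral_mono
      intro w
      have e : (2 : ℝ≥0∞) = ENNReal.ofReal 2 := by simp
      simp only
      rw [e, ← ENNReal.ofReal_mul (by positivity), ← ENNReal.ofReal_mul (by positivity), ← ENNReal.ofReal_add (by positivity) (by positivity)]
      apply ENNReal.ofReal_le_ofReal
      nlinarith [sq_nonneg (f p - f w + (f q - f w))]
    · apply Measurable.const_mul
      exact hmeas.comp measurable_prodMk_left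
  calc volume I * ∫⁻ p in A, ∫⁻ q in B, ENNReal.ofReal ((f p - f q) ^ 2)
      = ∫⁻ p in A, ∫⁻ q in B, volume I * ENNReal.ofReal ((f p - f q) ^ 2) := by
        rw [← lintegral_const_mul' _ _ hIf]
        apply lintegral_congr; intro p
        rw [← lintegral_const_mul' _ _ hIf]
    _ ≤ ∫⁻ p in A, ∫⁻ q in B, (2 * b p + 2 * b q) := by
        apply lintegral_mono; intro p; apply lintegral_mono; intro q; exact h1 p q
    _ = ∫⁻ p in A, (2 * b p * volume B + 2 * ∫⁻ q in B, b q) := by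
        apply lintegral_congr; intro p
        rw [lintegral_add_left measurable_const, setLIntegral_const, lintegral_const_mul' _ _ (by simp)]
    _ = 2 * (volume B * (∫⁻ p in A, b p) + volume A * ∫⁻ q in B, b q) := by
        rw [lintegral_add_right _ measurable_const, setLIntegral_const, lintegral_mul_const' _ _ hBf,
          lintegral_const_mul' _ _ (by simp)]
        ring
    _ ≤ _ := by
        gcongr with p q
        · exact lintegral_mono_set hIA
        · exact lintegral_mono_set hIB

def Adm (V : Euc d → ℝ) (a : ℝ) (O : Set (Euc d)) : Prop := IsOpen O ∧ GoodSet V a O ∧ DblSet V a O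

lemma dbl_union {V : Euc d → ℝ} {a : ℝ} {O1 O2 : Set (Euc d)} (h1 : Adm V a O1) (h2 : Adm V a O2) {z : Euc d}
    (hz1 : z ∈ O1) (hz2 : z ∈ O2) (hz : V z = 0) {y : Euc d} (hy : y ∈ O1) (hy0 : V y = 0) {N : Set (Euc d)}
    (hN : N ∈ 𝓝 y) : ∃ C : ℝ≥0∞, C ≠ ∞ ∧ ∃ ε₁ > (0:ℝ), ∀ ε : ℝ, 0 < ε → ε ≤ ε₁ →
    volume ((O1 ∪ O2) ∩ {x | V x ≤ a * ε}) ≤ C * volume (N ∩ {x | V x ≤ a * ε}) := by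
  obtain ⟨c, hc, e, he, h⟩ := h1.2.2 y hy hy0 N hN
  obtain ⟨c', hc', e', he', h'⟩ := h2.2.2 z hz2 hz O1 (h1.1.mem_nhds hz1)
  refine ⟨(1 + c') * c, ENNReal.mul_ne_top (by simp [hc']) hc, min e e', lt_min he he', fun ε h0 hle => ?_⟩
  have i1 := h ε h0 (hle.trans (min_le_left _ _))
  have i2 := h' ε h0 (hle.trans (min_le_right _ _))
  rw [union_inter_distrib_right]
  calc _ ≤ _ := measure_union_le _ _
    _ ≤ volume (O1 ∩ {x | V x ≤ a * ε}) + c' * volume (O1 ∩ {x | V x ≤ a * ε}) := by gcongr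
    _ = (1 + c') * volume (O1 ∩ {x | V x ≤ a * ε}) := by ring
    _ ≤ (1 + c') * (c * volume (N ∩ {x | V x ≤ a * ε})) := by gcongr
    _ = _ := by ring

lemma adm_union {V : Euc d → ℝ} (hVc : Continuous V) (hco : Tendsto V (cocompact (Euc d)) atTop) {a : ℝ} (ha : 0 < a)
    {O1 O2 : Set (Euc d)} (h1 : Adm V a O1) (h2 : Adm V a O2) {z : Euc d}
    (hz1 : z ∈ O1) (hz2 : z ∈ O2) (hz : V z = 0) : Adm V a (O1 ∪ O2) := by
  refine ⟨h1.1.union h2.1, ?_, ?_⟩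
  · obtain ⟨C1, hC1, e1, he1, g1⟩ := h1.2.1
    obtain ⟨C2, hC2, e2, he2, g2⟩ := h2.2.1
    obtain ⟨c1, hc1, e3, he3, g3⟩ := h1.2.2 z hz1 hz (O1 ∩ O2) ((h1.1.inter h2.1).mem_nhds ⟨hz1, hz2⟩)
    obtain ⟨c2, hc2, e4, he4, g4⟩ := h2.2.2 z hz2 hz (O1 ∩ O2) ((h1.1.inter h2.1).mem_nhds ⟨hz1, hz2⟩)
    refine ⟨C1 + 2 * (C1 + C2) * c2 + 2 * (C1 + C2) * c1 + C2, ?_, min (min e1 e2) (min e3 e4), by positivity, fun ε h0 hle f hf => ?_⟩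
    · simp [ENNReal.mul_eq_top, hC1, hC2, hc1, hc2]
    have i1 := g1 ε h0 (hle.trans ((min_le_left _ _).trans (min_le_left _ _))) f hf
    have i2 := g2 ε h0 (hle.trans ((min_le_left _ _).trans (min_le_right _ _))) f hf
    have i3 := g3 ε h0 (hle.trans ((min_le_right _ _).trans (min_le_left _ _)))
    have i4 := g4 ε h0 (hle.trans ((min_le_right _ _).trans (min_le_right _ _)))
    set U := {x | V x ≤ a * ε} with hU
    have hUf : volume U ≠ ∞ := (sublevel_compact hVc hco (a * ε)).measure_lt_top.ne
    set A := O1 ∩ U with hA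
    set B := O2 ∩ U with hB
    set I := (O1 ∩ O2) ∩ U with hI
    have hAf : volume A ≠ ∞ := ne_top_of_le_ne_top hUf (measure_mono inter_subset_right)
    have hBf : volume B ≠ ∞ := ne_top_of_le_ne_top hUf (measure_mono inter_subset_right)
    have hIA : I ⊆ A := fun x hx => ⟨hx.1.1, hx.2⟩
    have hIB : I ⊆ B := fun x hx => ⟨hx.1.2, hx.2⟩
    have hIf : volume I ≠ ∞ := ne_top_of_le_ne_top hAf (measure_mono hIA)
    have hI0 : volume I ≠ 0 := by
      have ho : IsOpen ((O1 ∩ O2) ∩ {x | V x < a * ε}) :=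
        (h1.1.inter h2.1).inter (isOpen_lt hVc continuous_const)
      have hne : ((O1 ∩ O2) ∩ {x | V x < a * ε}).Nonempty := ⟨z, ⟨hz1, hz2⟩, by
        show V z < a * ε; rw [hz]; positivity⟩
      have h3 := ho.measure_pos volume hne
      have hsub : ((O1 ∩ O2) ∩ {x | V x < a * ε}) ⊆ I := fun x hx =>
        ⟨hx.1, show V x ≤ a * ε from le_of_lt (show V x < a * ε from hx.2)⟩
      exact (h3.trans_le (measure_mono hsub)).ne'
    set D := DirE V f ε with hD
    have hcross : ∀ {A B : Set (Euc d)} {C1 C2 c : ℝ≥0∞}, I ⊆ A → I ⊆ B → volume A ≠ ∞ → volume B ≠ ∞ →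
        (∫⁻ p in A, ∫⁻ q in A, ENNReal.ofReal ((f p - f q) ^ 2) ≤ C1 * (volume A * D)) →
        (∫⁻ p in B, ∫⁻ q in B, ENNReal.ofReal ((f p - f q) ^ 2) ≤ C2 * (volume B * D)) →
        volume B ≤ c * volume I →
        ∫⁻ p in A, ∫⁻ q in B, ENNReal.ofReal ((f p - f q) ^ 2) ≤ 2 * (C1 + C2) * c * (volume A * D) := by
      intro A B C1 C2 c hIA hIB hAf hBf j1 j2 j3
      rw [← ENNReal.mul_le_mul_iff_right hI0 hIf]
      calc _ ≤ _ := cross_le hf.continuous hIA hIB hAf hBf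
        _ ≤ 2 * (volume B * (C1 * (volume A * D)) + volume A * (C2 * (volume B * D))) := by gcongr
        _ = 2 * (C1 + C2) * (volume A * D) * volume B := by ring
        _ ≤ 2 * (C1 + C2) * (volume A * D) * (c * volume I) := by gcongr
        _ = _ := by ring
    have j1 := hcross hIA hIB hAf hBf i1 i2 i4
    have j2 := hcross hIB hIA hBf hAf i2 i1 i3
    rw [union_inter_distrib_right]
    have hin : ∀ p, ∫⁻ q in A ∪ B, ENNReal.ofReal ((f p - f q) ^ 2) ≤
        (∫⁻ q in A, ENNReal.ofReal ((f p - f q) ^ 2)) + ∫⁻ q in B, ENNReal.ofReal ((f p - f q) ^ 2) := fun p =>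
      lintegral_union_le (fun q => ENNReal.ofReal ((f p - f q) ^ 2)) A B
    have hmeas : Measurable (fun p : Euc d × Euc d => ENNReal.ofReal ((f p.1 - f p.2) ^ 2)) := by
      have hfc := hf.continuous
      have : Continuous (fun p : Euc d × Euc d => (f p.1 - f p.2) ^ 2) := by fun_prop
      exact this.measurable.ennreal_ofReal
    have hmA : Measurable (fun p => ∫⁻ q in A, ENNReal.ofReal ((f p - f q) ^ 2)) := hmeas.lintegral_prod_right'
    have hvA : volume A ≤ volume (A ∪ B) := measure_mono subset_union_left
    have hvB : volume B ≤ volume (A ∪ B) := measure_mono subset_union_right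
    calc ∫⁻ p in A ∪ B, ∫⁻ q in A ∪ B, ENNReal.ofReal ((f p - f q) ^ 2)
        ≤ ∫⁻ p in A ∪ B, ((∫⁻ q in A, ENNReal.ofReal ((f p - f q) ^ 2)) + ∫⁻ q in B, ENNReal.ofReal ((f p - f q) ^ 2)) :=
          lintegral_mono hin
      _ ≤ _ := lintegral_union_le _ _ _
      _ = _ := by rw [lintegral_add_left hmA, lintegral_add_left hmA]
      _ ≤ C1 * (volume A * D) + 2 * (C1 + C2) * c2 * (volume A * D) +
          (2 * (C2 + C1) * c1 * (volume B * D) + C2 * (volume B * D)) := by gcongr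
      _ ≤ C1 * (volume (A ∪ B) * D) + 2 * (C1 + C2) * c2 * (volume (A ∪ B) * D) +
          (2 * (C2 + C1) * c1 * (volume (A ∪ B) * D) + C2 * (volume (A ∪ B) * D)) := by gcongr
      _ = _ := by ring
  · rintro y (hy | hy) hy0 N hN
    · exact dbl_union h1 h2 hz1 hz2 hz hy hy0 hN
    · rw [union_comm]
      exact dbl_union h2 h1 hz2 hz1 hz hy hy0 hN

lemma global_good {V : Euc d → ℝ} (hV : ContDiff ℝ 2 V) (hco : Tendsto V (cocompact (Euc d)) atTop)
    (h0 : ∀ x, 0 ≤ V x) (hmin : ∃ x, V x = 0) {ν : ℝ} (hν : 0 < ν)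
    {N : Set (Euc d)} (hN : IsOpen N) (hPL : ∀ x ∈ N, ν * V x ≤ ‖gradient V x‖ ^ 2)
    (hSN : {x | V x = 0} ⊆ N) (hpre : IsPreconnected {x | V x = 0}) {a : ℝ} (ha : 0 < a) :
    ∃ C : ℝ≥0∞, C ≠ ∞ ∧ ∃ ε₁ > (0:ℝ), ∀ ε : ℝ, 0 < ε → ε ≤ ε₁ → ∀ f : Euc d → ℝ, ContDiff ℝ 1 f →
    ∫⁻ p in {x | V x ≤ a * ε}, ∫⁻ q in {x | V x ≤ a * ε}, ENNReal.ofReal ((f p - f q) ^ 2) ≤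
      C * (volume {x | V x ≤ a * ε} * DirE V f ε) := by
  have hVc := hV.continuous
  set S := {x | V x = 0} with hS
  have hloc : ∀ y ∈ S, ∃ O, Adm V a O ∧ y ∈ O := by
    intro y hy
    obtain ⟨O, h1, h2, h3, h4⟩ := local_good hV h0 hν hN hPL (hSN hy) hy ha
    exact ⟨O, ⟨h1, h3, h4⟩, h2⟩
  obtain ⟨x0, hx0⟩ := hmin
  let A1 : Set (Euc d) := ⋃₀ {O | Adm V a O ∧ x0 ∈ O}
  let A2 : Set (Euc d) := ⋃₀ {O | Adm V a O ∧ ∀ z ∈ O, z ∈ A1 → z ∉ S}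
  have hA1 : IsOpen A1 := isOpen_sUnion fun O hO => hO.1.1
  have hA2 : IsOpen A2 := isOpen_sUnion fun O hO => hO.1.1
  have hx0A1 : x0 ∈ A1 := by
    obtain ⟨O, hO, hx⟩ := hloc x0 hx0
    exact ⟨O, ⟨hO, hx⟩, hx⟩
  have hcov : S ⊆ A1 ∪ A2 := by
    intro y hy
    obtain ⟨O, hO, hyO⟩ := hloc y hy
    by_cases h : ∀ z ∈ O, z ∈ A1 → z ∉ S
    · exact Or.inr ⟨O, ⟨hO, h⟩, hyO⟩
    · push Not at h
      obtain ⟨z, hzO, ⟨O', ⟨hO', hxO'⟩, hzO'⟩, hzS⟩ := h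
      exact Or.inl ⟨O ∪ O', ⟨adm_union hVc hco ha hO hO' hzO hzO' hzS, Or.inr hxO'⟩, Or.inl hyO⟩
  have hSA1 : S ⊆ A1 := by
    intro y hy
    by_contra hyA
    have hy2 : y ∈ A2 := (hcov hy).resolve_left hyA
    obtain ⟨z, hzS, hz1, O, ⟨hO, hOz⟩, hzO⟩ := hpre A1 A2 hA1 hA2 hcov ⟨x0, hx0, hx0A1⟩ ⟨y, hy, hy2⟩
    exact hOz z hzO hz1 hzS
  have hSle : S = {x | V x ≤ 0} := by
    ext x; exact ⟨fun h => le_of_eq h, fun h => le_antisymm h (h0 x)⟩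
  have hSc : IsCompact S := by rw [hSle]; exact sublevel_compact hVc hco 0
  have hfin : ∃ O, Adm V a O ∧ x0 ∈ O ∧ S ⊆ O := by
    apply hSc.induction_on (p := fun t => ∃ O, Adm V a O ∧ x0 ∈ O ∧ t ⊆ O)
    · obtain ⟨O, hO, hx⟩ := hloc x0 hx0
      exact ⟨O, hO, hx, empty_subset _⟩
    · rintro s t hst ⟨O, hO, hx, htO⟩
      exact ⟨O, hO, hx, hst.trans htO⟩
    · rintro s t ⟨O, hO, hx, hsO⟩ ⟨O', hO', hx', htO'⟩
      exact ⟨O ∪ O', adm_union hVc hco ha hO hO' hx hx' hx0, Or.inl hx, union_subset_union hsO htO'⟩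
    · intro y hy
      obtain ⟨O, ⟨hO, hxO⟩, hyO⟩ := hSA1 hy
      exact ⟨O, mem_nhdsWithin_of_mem_nhds (hO.1.mem_nhds hyO), O, hO, hxO, Subset.rfl⟩
  obtain ⟨O, hO, -, hSO⟩ := hfin
  rw [hSle] at hSO
  obtain ⟨c', hc', hsub⟩ := sublevel_sub hVc hco hO.1 hSO
  obtain ⟨C, hC, e, he, h⟩ := hO.2.1
  refine ⟨C, hC, min e (c' / a), lt_min he (by positivity), fun ε hε hle f hf => ?_⟩
  have h1 := h ε hε (hle.trans (min_le_left _ _)) f hf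
  have h2 := hle.trans (min_le_right _ _)
  rw [le_div_iff₀ ha] at h2
  have h3 : O ∩ {x | V x ≤ a * ε} = {x | V x ≤ a * ε} := by
    apply inter_eq_right.2
    intro x hx
    apply hsub
    have hx' : V x ≤ a * ε := hx
    show V x ≤ c'
    linarith
  rwa [h3] at h1

lemma gibbs_integrable {V : Euc d → ℝ} (hVc : Continuous V) {ε : ℝ}
    (hZ : Integrable (fun x => exp (-V x / ε))) (g : Euc d → ℝ) :
    Integrable g (gibbs V ε) ↔ Integrable (fun x => g x * exp (-V x / ε)) := by
  have hZ0 : 0 < ∫ x, exp (-V x / ε) := integral_exp_pos hZ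
  have hm : Measurable (fun x => ENNReal.ofReal (exp (-V x / ε))) := by
    have : Continuous (fun x => exp (-V x / ε)) := by fun_prop
    exact this.measurable.ennreal_ofReal
  unfold gibbs
  rw [integrable_smul_measure (by simp) (by simpa using hZ0),
    integrable_withDensity_iff_integrable_smul' hm (by simp)]
  refine integrable_congr (Eventually.of_forall fun x => ?_)
  simp only [ENNReal.toReal_ofReal (exp_pos _).le, smul_eq_mul, mul_comm]

lemma gibbs_integral {V : Euc d → ℝ} (hVc : Continuous V) {ε : ℝ}
    (hZ : Integrable (fun x => exp (-V x / ε))) (g : Euc d → ℝ) :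
    ∫ x, g x ∂(gibbs V ε) = (∫ x, exp (-V x / ε))⁻¹ * ∫ x, g x * exp (-V x / ε) := by
  have hZ0 : 0 < ∫ x, exp (-V x / ε) := integral_exp_pos hZ
  have hm : Measurable (fun x => ENNReal.ofReal (exp (-V x / ε))) := by
    have : Continuous (fun x => exp (-V x / ε)) := by fun_prop
    exact this.measurable.ennreal_ofReal
  unfold gibbs
  rw [integral_smul_measure, integral_withDensity_eq_integral_toReal_smul hm (by simp)]
  simp only [ENNReal.toReal_inv, ENNReal.toReal_ofReal hZ0.le, ENNReal.toReal_ofReal (exp_pos _).le,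
    smul_eq_mul, mul_comm]

lemma gibbs_prob {V : Euc d → ℝ} {ε : ℝ}
    (hZ : Integrable (fun x => exp (-V x / ε))) : IsProbabilityMeasure (gibbs V ε) := by
  have hZ0 : 0 < ∫ x, exp (-V x / ε) := integral_exp_pos hZ
  constructor
  unfold gibbs
  rw [Measure.smul_apply, withDensity_apply _ MeasurableSet.univ, Measure.restrict_univ,
    ← ofReal_integral_eq_lintegral_ofReal hZ (Eventually.of_forall fun x => (exp_pos _).le), smul_eq_mul]
  exact ENNReal.inv_mul_cancel (by simpa using hZ0) (by simp)

lemma var_le {Ω : Type*} [MeasurableSpace Ω] {μ : Measure Ω} [IsProbabilityMeasure μ] {f : Ω → ℝ}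
    (hf : Integrable f μ) (hf2 : Integrable (fun x => f x ^ 2) μ) (m : ℝ) :
    ∫ x, (f x - ∫ y, f y ∂μ) ^ 2 ∂μ ≤ ∫ x, (f x - m) ^ 2 ∂μ := by
  have key : ∀ t : ℝ, ∫ x, (f x - t) ^ 2 ∂μ = (∫ x, f x ^ 2 ∂μ) - 2 * t * (∫ x, f x ∂μ) + t ^ 2 := by
    intro t
    have : ∀ x, (f x - t) ^ 2 = f x ^ 2 - 2 * t * f x + t ^ 2 := fun x => by ring
    simp only [this]
    have hsb : Integrable (fun x => f x ^ 2 - 2 * t * f x) μ := hf2.sub (hf.const_mul _)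
    rw [integral_add hsb (integrable_const _),
      integral_sub hf2 (hf.const_mul _), integral_const_mul]
    simp
  rw [key, key]
  nlinarith [sq_nonneg (m - ∫ y, f y ∂μ)]

lemma final_step {V f : Euc d → ℝ} (hV : ContDiff ℝ 2 V) (hco : Tendsto V (cocompact (Euc d)) atTop)
    (h0 : ∀ x, 0 ≤ V x) (hmin : ∃ x, V x = 0) (hf : ContDiff ℝ 1 f) {ε a c B : ℝ} (hε : 0 < ε)
    (ha : 0 < a) (hc : 0 < c) (hB : 0 ≤ B)
    (hphi : ∀ x : Euc d, (c ≤ ‖gradient V x‖ ^ 2 / (4 * ε) - lap V x / 2) ∨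
      (V x ≤ a * ε ∧ -B ≤ ‖gradient V x‖ ^ 2 / (4 * ε) - lap V x / 2))
    {C : ℝ≥0∞} (hC : C ≠ ∞)
    (hgood : ∫⁻ p in {x | V x ≤ a * ε}, ∫⁻ q in {x | V x ≤ a * ε}, ENNReal.ofReal ((f p - f q) ^ 2) ≤
      C * (volume {x | V x ≤ a * ε} * DirE V f ε))
    (hZ : Integrable (fun x => exp (-V x / ε)))
    (hf2 : Integrable (fun x => f x ^ 2 * exp (-V x / ε)))
    (hg2 : Integrable (fun x => ‖gradient f x‖ ^ 2 * exp (-V x / ε))) :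
    ∃ m : ℝ, c * ∫ x, (f x - m) ^ 2 * exp (-V x / ε) ≤
      (2 * ε + (B + c) * C.toReal) * ∫ x, ‖gradient f x‖ ^ 2 * exp (-V x / ε) := by
  have hVc := hV.continuous
  have hfc := hf.continuous
  set U := {x | V x ≤ a * ε} with hU
  have hUc : IsCompact U := sublevel_compact hVc hco _
  have hUf : volume U ≠ ∞ := hUc.measure_lt_top.ne
  have hU0 : volume U ≠ 0 := by
    have ho : IsOpen {x | V x < a * ε} := isOpen_lt hVc continuous_const
    obtain ⟨z, hz⟩ := hmin
    have hne : {x | V x < a * ε}.Nonempty := ⟨z, by show V z < a * ε; rw [hz]; positivity⟩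
    have hsub : {x | V x < a * ε} ⊆ U := fun x hx =>
      show V x ≤ a * ε from le_of_lt (show V x < a * ε from hx)
    exact ((ho.measure_pos volume hne).trans_le (measure_mono hsub)).ne'
  have hmeas : Measurable (fun p : Euc d × Euc d => ENNReal.ofReal ((f p.1 - f p.2) ^ 2)) := by
    have : Continuous (fun p : Euc d × Euc d => (f p.1 - f p.2) ^ 2) := by fun_prop
    exact this.measurable.ennreal_ofReal
  have hmU : Measurable (fun p => ∫⁻ q in U, ENNReal.ofReal ((f p - f q) ^ 2)) := hmeas.lintegral_prod_right'
  obtain ⟨p, hp, hpa⟩ := exists_le_setLAverage hU0 hUf hmU.aemeasurable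
  have hD : DirE V f ε = ENNReal.ofReal (∫ x, ‖gradient f x‖ ^ 2 * exp (-V x / ε)) := by
    unfold DirE
    rw [ofReal_integral_eq_lintegral_ofReal hg2]
    exact Eventually.of_forall fun x => by positivity
  set G := ∫ x, ‖gradient f x‖ ^ 2 * exp (-V x / ε) with hG
  have hG0 : 0 ≤ G := integral_nonneg fun x => by positivity
  have hp2 : ∫⁻ q in U, ENNReal.ofReal ((f p - f q) ^ 2) ≤ ENNReal.ofReal (C.toReal * G) := by
    refine hpa.trans ?_
    rw [setLAverage_eq]
    refine ENNReal.div_le_of_le_mul ?_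
    refine hgood.trans (le_of_eq ?_)
    rw [hD, ENNReal.ofReal_mul ENNReal.toReal_nonneg, ENNReal.ofReal_toReal hC]
    ring
  refine ⟨f p, ?_⟩
  have hgrad : gradient (fun x => f x - f p) = gradient f := by
    funext x
    unfold gradient
    rw [fderiv_sub_const]
  have hf2' : Integrable (fun x => (f x - f p) ^ 2 * exp (-V x / ε)) := by
    refine Integrable.mono' ((hf2.const_mul 2).add (hZ.const_mul (2 * (f p) ^ 2))) ?_ ?_
    · have : Continuous (fun x => (f x - f p) ^ 2 * exp (-V x / ε)) := by fun_prop
      exact this.aestronglyMeasurable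
    · refine Eventually.of_forall fun x => ?_
      have he := exp_pos (-V x / ε)
      rw [Real.norm_of_nonneg (by positivity)]
      show _ ≤ 2 * (f x ^ 2 * exp (-V x / ε)) + 2 * (f p) ^ 2 * exp (-V x / ε)
      nlinarith [mul_nonneg (sq_nonneg (f x + f p)) he.le]
  have hl := lyap (f := fun x => f x - f p) hV (by fun_prop) hε hc hB hphi hf2' (by rw [hgrad]; exact hg2)
  rw [hgrad] at hl
  have hI : ∫ x in U, (f x - f p) ^ 2 * exp (-V x / ε) ≤ C.toReal * G := by
    rw [integral_eq_lintegral_of_nonneg_ae (Eventually.of_forall fun x => by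
      show 0 ≤ (f x - f p) ^ 2 * exp (-V x / ε); positivity) hf2'.aestronglyMeasurable.restrict]
    refine ENNReal.toReal_le_of_le_ofReal (mul_nonneg ENNReal.toReal_nonneg hG0) ?_
    refine le_trans (lintegral_mono fun x => ?_) hp2
    refine ENNReal.ofReal_le_ofReal ?_
    have he : exp (-V x / ε) ≤ 1 := by
      rw [exp_le_one_iff]
      exact div_nonpos_of_nonpos_of_nonneg (by linarith [h0 x]) hε.le
    nlinarith [sq_nonneg (f x - f p)]
  calc _ ≤ _ := hl
    _ ≤ 2 * ε * G + (B + c) * (C.toReal * G) := by gcongr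
    _ = _ := by ring

theorem main_aux
    {d : ℕ} (hd : 2 ≤ d) (V : Euc d → ℝ) (hV : ContDiff ℝ 2 V)
    (ν : ℝ) (𝒩 : Set (Euc d) → Set (Euc d))
    (h1 : Assumption1 V ν 𝒩) (h2 : Assumption2 V 𝒩)
    (R₀ ν_eb C_g : ℝ) (h3 : Assumption3 V R₀ ν_eb C_g)
    (hmin0 : ∀ x, 0 ≤ V x) (hmin : ∃ x, V x = 0)
    (hZ : ∀ ε : ℝ, 0 < ε → Integrable (fun x => exp (-V x / ε))) :
    ∃ ε₀ > (0 : ℝ), ∃ c > (0 : ℝ),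
      ∀ ε : ℝ, 0 < ε → ε ≤ ε₀ → PoincareIneq (gibbs V ε) c := by
  have hVc := hV.continuous
  have hν := h1.1
  have hco := h3.2.2.2.2.1
  obtain ⟨hS, hpre, N, hN, hSN, hPL, hND⟩ := topo_summary hd V hV ν 𝒩 h1 h2 hco hmin0 hmin
  have hne : (localMinSet V).Nonempty := by rw [hS]; exact hmin
  obtain ⟨a, ha, c, hc, B, hB, ε₁, hε₁, hphi⟩ := phi_bound hd hV hν h3 hne hN hPL hND
  obtain ⟨C, hC, ε₂, hε₂, hgood⟩ := global_good hV hco hmin0 hmin hν hN hPL hSN hpre ha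
  set K : ℝ := (2 + (B + c) * C.toReal) / c with hK
  have hCr : 0 ≤ C.toReal := ENNReal.toReal_nonneg
  have hB' : 0 ≤ B := hB
  have hK0 : 0 < K := by positivity
  refine ⟨min 1 (min ε₁ ε₂), by positivity, 1 / K, by positivity, ?_⟩
  intro ε hε hεle f hf hf2 hg2
  have e0 : ε ≤ 1 := hεle.trans (min_le_left _ _)
  have e1 : ε ≤ ε₁ := hεle.trans ((min_le_right _ _).trans (min_le_left _ _))
  have e2 : ε ≤ ε₂ := hεle.trans ((min_le_right _ _).trans (min_le_right _ _))
  have hZε := hZ ε hε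
  have hZ0 : 0 < ∫ x, exp (-V x / ε) := integral_exp_pos hZε
  have := gibbs_prob hZε
  have hf1 : Integrable f (gibbs V ε) := by
    refine Integrable.mono' (hf2.add (integrable_const (1 : ℝ))) hf.continuous.aestronglyMeasurable ?_
    refine Eventually.of_forall fun x => ?_
    show ‖f x‖ ≤ f x ^ 2 + 1
    rw [Real.norm_eq_abs, ← sq_abs]
    nlinarith [sq_nonneg (|f x| - 1), abs_nonneg (f x)]
  obtain ⟨m, hm⟩ := final_step hV hco hmin0 hmin hf hε ha hc hB (hphi ε hε e1) hC (hgood ε hε e2 f hf) hZε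
    ((gibbs_integrable hVc hZε _).1 hf2) ((gibbs_integrable hVc hZε _).1 hg2)
  refine (var_le hf1 hf2 m).trans ?_
  rw [gibbs_integral hVc hZε, gibbs_integral hVc hZε, one_div_one_div]
  set G := ∫ x, ‖gradient f x‖ ^ 2 * exp (-V x / ε) with hG
  have hG0 : 0 ≤ G := integral_nonneg fun x => by positivity
  have : ∫ x, (f x - m) ^ 2 * exp (-V x / ε) ≤ K * G := by
    rw [hK, div_mul_eq_mul_div, le_div_iff₀ hc, mul_comm]
    refine hm.trans ?_
    gcongr
    linarith
  calc _ ≤ (∫ x, exp (-V x / ε))⁻¹ * (K * G) := by gcongr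
    _ = _ := by ring

/-- main theorem, informal version: for a `PL°` potential `V`
(Assumptions 1–3) with `min V = 0` whose set of local minima is not a singleton,
in dimension `d ≥ 2`, the Poincaré constant of the Gibbs measure `μ_ε` admits a
temperature-independent positive lower bound for all sufficiently small `ε`. -/
theorem gibbs_poincare_temperature_independent
    {d : ℕ} (hd : 2 ≤ d) (V : Euc d → ℝ) (hV : ContDiff ℝ 2 V)
    (ν : ℝ) (𝒩 : Set (Euc d) → Set (Euc d))
    (h1 : Assumption1 V ν 𝒩) (h2 : Assumption2 V 𝒩)
    (R₀ ν_eb C_g : ℝ) (h3 : Assumption3 V R₀ ν_eb C_g)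
    (hmin0 : ∀ x, 0 ≤ V x) (hmin : ∃ x, V x = 0)
    (hns : ∀ x : Euc d, localMinSet V ≠ {x})
    (hZ : ∀ ε : ℝ, 0 < ε → Integrable (fun x => exp (-V x / ε))) :
    ∃ ε₀ > (0 : ℝ), ∃ c > (0 : ℝ),
      ∀ ε : ℝ, 0 < ε → ε ≤ ε₀ → PoincareIneq (gibbs V ε) c := by
  exact main_aux hd V hV ν 𝒩 h1 h2 R₀ ν_eb C_g h3 hmin0 hmin hZ
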